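/- Let H be a graph that is 3-connected or isomorphic to K_3, let q ≥ 2 be an integer, and let F be a graph that is not q-Ramsey for H. Then there are infinitely many graphs G that are q-Ramsey-minimal for H and contain F as an induced subgraph; that is, for every natural number N there exists a graph G on more than N vertices such that G is q-Ramsey-minimal for H and G contains an induced subgraph isomorphic to F. -/

import Mathlib

open SimpleGraph

/-- The colouring `c` contains a copy of `H` in `G` all of whose edges have colour `i`. -/
def HasMonoCopyColor {V W : Type*} (G : SimpleGraph V) (H : SimpleGraph W) {q : ℕ}
    (c : Sym2 V → Fin q) (i : Fin q) : Prop :=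
  ∃ f : W ↪ V, ∀ a b, H.Adj a b → G.Adj (f a) (f b) ∧ c s(f a, f b) = i

/-- The colouring `c` contains a monochromatic copy of `H` in `G`. -/
def HasMonoCopy {V W : Type*} (G : SimpleGraph V) (H : SimpleGraph W) {q : ℕ}
    (c : Sym2 V → Fin q) : Prop :=
  ∃ i : Fin q, HasMonoCopyColor G H c i

/-- `G` is `q`-Ramsey for `H`: every `q`-colouring of the edges of `G` contains a
monochromatic copy of `H`. -/
def IsRamsey (q : ℕ) {V W : Type*} (G : SimpleGraph V) (H : SimpleGraph W) : Prop :=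
  ∀ c : Sym2 V → Fin q, HasMonoCopy G H c

/-- `G` is `q`-Ramsey-minimal for `H`: `G` is `q`-Ramsey for `H` but no proper
subgraph of `G` is. -/
def IsRamseyMinimal (q : ℕ) {V W : Type*} (G : SimpleGraph V) (H : SimpleGraph W) : Prop :=
  IsRamsey q G H ∧ ∀ G' : G.Subgraph, G' ≠ ⊤ → ¬ IsRamsey q G'.coe H

/-- `H` is 3-connected: it has at least 4 vertices and deleting any set of at most
2 vertices leaves a connected graph. -/
def ThreeConnected {V : Type*} [Fintype V] (H : SimpleGraph V) : Prop :=
  4 ≤ Fintype.card V ∧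
    ∀ S : Finset V, S.card ≤ 2 → (H.induce ((↑S : Set V)ᶜ)).Connected

/-- `H` is 3-connected or isomorphic to `K₃`. -/
def ThreeConnOrK3 {V : Type*} [Fintype V] (H : SimpleGraph V) : Prop :=
  ThreeConnected H ∨ Nonempty (H ≃g (⊤ : SimpleGraph (Fin 3)))

namespace RamseySender

section

/-- The colouring `c` of `G` has no monochromatic copy of `H`. -/
def HFree {V W : Type} (H : SimpleGraph W) (G : SimpleGraph V) {q : ℕ}
    (c : Sym2 V → Fin q) : Prop :=
  ¬ HasMonoCopy G H c

/-- No two vertices separate `H`, phrased through sets closed under adjacency. -/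
structure Robust {W : Type} [Fintype W] (H : SimpleGraph W) : Prop where
  closed : ∀ (x y : W) (C : Set W), C.Nonempty → x ∉ C → y ∉ C →
    (∀ a ∈ C, ∀ b, H.Adj a b → b ∈ C ∨ b = x ∨ b = y) → ∀ b, b ∈ C ∨ b = x ∨ b = y
  card : 3 ≤ Fintype.card W

lemma robust_of_threeConnOrK3 {W : Type} [Fintype W] {H : SimpleGraph W}
    (h : ThreeConnOrK3 H) : Robust H := by
  classical
  rcases h with ⟨h4, h⟩ | ⟨⟨φ⟩⟩
  · refine ⟨fun x y C hC hx hy hcl b => ?_, by omega⟩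
    by_contra hb
    push Not at hb
    obtain ⟨hbC, hbx, hby⟩ := hb
    obtain ⟨a, ha⟩ := hC
    have hcon := (h {x, y} Finset.card_le_two).preconnected
    have haS : a ∈ ((↑({x, y} : Finset W) : Set W)ᶜ) := by
      simp only [Finset.coe_insert, Finset.coe_singleton, Set.mem_compl_iff, Set.mem_insert_iff,
        Set.mem_singleton_iff, not_or]
      exact ⟨fun e => hx (e ▸ ha), fun e => hy (e ▸ ha)⟩
    have hbS : b ∈ ((↑({x, y} : Finset W) : Set W)ᶜ) := by
      simp [hbx, hby]
    obtain ⟨p⟩ := hcon ⟨a, haS⟩ ⟨b, hbS⟩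
    have key : ∀ (u v : ((↑({x, y} : Finset W) : Set W)ᶜ : Set W)),
        (H.induce ((↑({x, y} : Finset W) : Set W)ᶜ)).Walk u v → (u : W) ∈ C → (v : W) ∈ C := by
      intro u v p
      induction p with
      | nil => exact id
      | @cons u v w huv p ih =>
        intro hu
        apply ih
        have hv := v.2
        simp only [Finset.coe_insert, Finset.coe_singleton, Set.mem_compl_iff, Set.mem_insert_iff,
          Set.mem_singleton_iff, not_or] at hv
        rcases hcl u hu v huv with h | h | h
        · exact h
        · exact absurd h hv.1
        · exact absurd h hv.2
    exact hbC (key _ _ p ha)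
  · refine ⟨fun x y C hC hx hy hcl b => ?_, ?_⟩
    · obtain ⟨a, ha⟩ := hC
      by_cases hab : a = b
      · exact Or.inl (hab ▸ ha)
      · refine hcl a ha b (φ.map_adj_iff.1 ?_)
        simpa using hab
    · rw [Fintype.card_congr φ.toEquiv]; simp

section

variable {W : Type} [Fintype W] {H : SimpleGraph W}

lemma Robust.exists_adj_ne (hH : Robust H) (a x : W) : ∃ b, H.Adj a b ∧ b ≠ x := by
  classical
  have key : ∀ y, y ≠ a → ∃ b, H.Adj a b ∧ b ≠ y := by
    intro y hy
    by_contra! hcon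
    have h2 := hH.closed y y {a} ⟨a, rfl⟩ (by simpa using hy) (by simpa using hy)
      (by
        intro a' ha' b hb
        rw [Set.mem_singleton_iff] at ha'
        subst ha'
        exact Or.inr (Or.inl (hcon b hb)))
    have : (Finset.univ : Finset W) ⊆ {a, y} := by
      intro b _
      have := h2 b
      simpa using this
    have h3 := Finset.card_le_card this
    have h4 := hH.card
    have h5 : ({a, y} : Finset W).card ≤ 2 := Finset.card_le_two
    rw [Finset.card_univ] at h3
    omega
  by_cases hx : x = a
  · have : Nontrivial W := Fintype.one_lt_card_iff_nontrivial.1 (by have := hH.card; omega)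
    obtain ⟨y, hy⟩ := exists_ne a
    obtain ⟨b, hb, -⟩ := key y hy
    exact ⟨b, hb, hx ▸ hb.ne'⟩
  · exact key x hx

lemma Robust.nonempty (hH : Robust H) : Nonempty W :=
  Fintype.card_pos_iff.1 (by have := hH.card; omega)

variable {V V' : Type} {q : ℕ}

lemma HFree.comap {G : SimpleGraph V} {G' : SimpleGraph V'} (φ : V → V')
    (hφ : Function.Injective φ) (hadj : ∀ u v, G.Adj u v → G'.Adj (φ u) (φ v))
    {c : Sym2 V' → Fin q} (h : HFree H G' c) : HFree H G (c ∘ Sym2.map φ) := by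
  rintro ⟨i, f, hf⟩
  refine h ⟨i, ⟨fun a => φ (f a), hφ.comp f.injective⟩,
    fun a b hab => ⟨hadj _ _ (hf a b hab).1, ?_⟩⟩
  have := (hf a b hab).2
  simpa using this

lemma HFree.mono {G G' : SimpleGraph V} (hle : G ≤ G') {c : Sym2 V → Fin q}
    (h : HFree H G' c) : HFree H G c := by
  rintro ⟨i, f, hf⟩
  exact h ⟨i, f, fun a b hab => ⟨hle (hf a b hab).1, (hf a b hab).2⟩⟩

lemma HFree.comp_perm {G : SimpleGraph V} (σ : Equiv.Perm (Fin q)) {c : Sym2 V → Fin q}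
    (h : HFree H G c) : HFree H G (σ ∘ c) := by
  rintro ⟨i, f, hf⟩
  refine h ⟨σ.symm i, f, fun a b hab => ⟨(hf a b hab).1, ?_⟩⟩
  rw [← (hf a b hab).2]
  simp

lemma not_isRamsey_iff {G : SimpleGraph V} :
    ¬ IsRamsey q G H ↔ ∃ c : Sym2 V → Fin q, HFree H G c := by
  simp [IsRamsey, HFree]

/-- Every vertex of a copy of `H` has, inside the copy, a neighbour other than a given vertex. -/
lemma Robust.exists_adj_image_ne (hH : Robust H) {G : SimpleGraph V} {f : W ↪ V}
    (hf : ∀ a b, H.Adj a b → G.Adj (f a) (f b)) (a : W) (v : V) :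
    ∃ b, H.Adj a b ∧ G.Adj (f a) (f b) ∧ f b ≠ v := by
  classical
  by_cases hv : ∃ x, f x = v
  · obtain ⟨x, rfl⟩ := hv
    obtain ⟨b, hb, hbx⟩ := hH.exists_adj_ne a x
    exact ⟨b, hb, hf _ _ hb, fun h => hbx (f.injective h)⟩
  · obtain ⟨b, hb, -⟩ := hH.exists_adj_ne a a
    exact ⟨b, hb, hf _ _ hb, fun h => hv ⟨b, h⟩⟩

end

end

section

/-- Ramsey's theorem for edge colourings with finitely many colours. -/
lemma exists_mono_clique {q : ℕ} (hq : 0 < q) (t : Fin q → ℕ) :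
    ∃ N, ∀ (α : Type) (S : Finset α) (c : Sym2 α → Fin q), N ≤ S.card →
      ∃ i, ∃ T ⊆ S, T.card = t i ∧ ∀ x ∈ T, ∀ y ∈ T, x ≠ y → c s(x, y) = i := by
  classical
  have : Nonempty (Fin q) := ⟨⟨0, hq⟩⟩
  induction hm : ∑ i, t i using Nat.strong_induction_on generalizing t with
  | _ m ih =>
  by_cases h0 : ∃ i, t i = 0
  · obtain ⟨i, hi⟩ := h0
    exact ⟨0, fun α S c _ => ⟨i, ∅, by simp, by simp [hi], by simp⟩⟩
  push Not at h0
  have key : ∀ i, ∃ N, ∀ (α : Type) (S : Finset α) (c : Sym2 α → Fin q), N ≤ S.card →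
      ∃ j, ∃ T ⊆ S, T.card = Function.update t i (t i - 1) j ∧
        ∀ x ∈ T, ∀ y ∈ T, x ≠ y → c s(x, y) = j := by
    intro i
    refine ih _ ?_ _ rfl
    rw [← hm]
    refine Finset.sum_lt_sum (fun j _ => ?_) ⟨i, Finset.mem_univ _, ?_⟩
    · by_cases hj : j = i
      · subst hj; simp
      · simp [hj]
    · have := h0 i
      simp; omega
  choose N hN using key
  refine ⟨1 + ∑ i, N i, fun α S c hS => ?_⟩
  obtain ⟨v, hv⟩ : S.Nonempty := Finset.card_pos.1 (by omega)
  have hsum : ∑ i, N i ≤ ∑ i, ((S.erase v).filter (fun x => c s(v, x) = i)).card := by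
    rw [← Finset.card_eq_sum_card_fiberwise (fun x _ => Finset.mem_coe.2 (Finset.mem_univ _)),
      Finset.card_erase_of_mem hv]
    omega
  obtain ⟨i, -, hi⟩ := Finset.exists_le_of_sum_le (Finset.univ_nonempty) hsum
  obtain ⟨j, T, hT, hcard, hmono⟩ := hN i α _ c hi
  by_cases hji : j = i
  · subst hji
    have hvT : v ∉ T := fun h => by simpa using hT h
    refine ⟨j, insert v T, ?_, ?_, ?_⟩
    · refine Finset.insert_subset hv (hT.trans ?_)
      exact (Finset.filter_subset _ _).trans (Finset.erase_subset _ _)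
    · rw [Finset.card_insert_of_notMem hvT, hcard]
      have := h0 j
      simp; omega
    · have hvc : ∀ x ∈ T, c s(v, x) = j := fun x hx => (Finset.mem_filter.1 (hT hx)).2
      intro x hx y hy hxy
      rcases Finset.mem_insert.1 hx with rfl | hx' <;> rcases Finset.mem_insert.1 hy with rfl | hy'
      · exact absurd rfl hxy
      · exact hvc y hy'
      · rw [Sym2.eq_swap]; exact hvc x hx'
      · exact hmono x hx' y hy' hxy
  · refine ⟨j, T, hT.trans ((Finset.filter_subset _ _).trans (Finset.erase_subset _ _)), ?_, hmono⟩
    simpa [hji] using hcard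

variable {W : Type} [Fintype W] {H : SimpleGraph W} {q : ℕ}

lemma exists_isRamsey_top (H : SimpleGraph W) (hq : 0 < q) :
    ∃ N, IsRamsey q (⊤ : SimpleGraph (Fin N)) H := by
  obtain ⟨N, hN⟩ := exists_mono_clique hq (fun _ => Fintype.card W)
  refine ⟨N, fun c => ?_⟩
  obtain ⟨i, T, -, hT, hmono⟩ := hN (Fin N) Finset.univ c (by simp)
  obtain ⟨e⟩ : Nonempty (W ≃ T) := ⟨Fintype.equivOfCardEq (by simp [hT])⟩
  refine ⟨i, e.toEmbedding.trans (Function.Embedding.subtype _), fun a b hab => ?_⟩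
  have hne : ((e a : T) : Fin N) ≠ e b := fun h => hab.ne (e.injective (Subtype.ext h))
  exact ⟨hne, hmono _ (e a).2 _ (e b).2 hne⟩

lemma not_isRamsey_bot (hH : Robust H) (hq : 0 < q) {V : Type} :
    ¬ IsRamsey q (⊥ : SimpleGraph V) H := by
  intro h
  obtain ⟨i, f, hf⟩ := h (fun _ => ⟨0, hq⟩)
  obtain ⟨a⟩ := hH.nonempty
  obtain ⟨b, hb, -⟩ := hH.exists_adj_ne a a
  exact (hf a b hb).1

/-- There is a graph that is not Ramsey and has a vertex seeing all colours in every colouring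
without monochromatic copies. -/
lemma exists_rainbow_vertex (hH : Robust H) (hq : 0 < q) :
    ∃ (V : Type) (_ : Finite V) (B : SimpleGraph V) (w : V), ¬ IsRamsey q B H ∧
      ∀ c : Sym2 V → Fin q, HFree H B c → ∀ i, ∃ a, B.Adj w a ∧ c s(w, a) = i := by
  classical
  obtain ⟨N, hN⟩ := exists_isRamsey_top H hq
  obtain ⟨B, hB⟩ := (Set.toFinite {G : SimpleGraph (Fin N) | ¬ IsRamsey q G H}).exists_maximal
    ⟨⊥, not_isRamsey_bot hH hq⟩
  have hBR : ¬ IsRamsey q B H := hB.1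
  obtain ⟨w, z, hwz, hnadj⟩ : ∃ w z, w ≠ z ∧ ¬ B.Adj w z := by
    by_contra! hcon
    exact hBR ((show B = ⊤ from top_le_iff.1 fun a b hab => hcon a b hab) ▸ hN)
  refine ⟨Fin N, inferInstance, B, w, hBR, fun c hc i => ?_⟩
  have hram : IsRamsey q (B ⊔ edge w z) H := by
    by_contra hcon
    have := hB.2 hcon le_sup_left
    exact hnadj (this (Or.inr (by simp [edge_adj, hwz])))
  obtain ⟨j, f, hf⟩ := hram (Function.update c s(w, z) i)
  have hother : ∀ u v, (B ⊔ edge w z).Adj u v → s(u, v) ≠ s(w, z) → B.Adj u v := by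
    intro u v huv hne
    rcases huv with h | h
    · exact h
    · rw [edge_adj] at h
      exact absurd (by simpa using h.1) hne
  obtain ⟨a, b, hab, hfab⟩ : ∃ a b, H.Adj a b ∧ s(f a, f b) = s(w, z) := by
    by_contra! hcon
    refine hc ⟨j, f, fun a b hab => ?_⟩
    have h2 := hf a b hab
    exact ⟨hother _ _ h2.1 (hcon a b hab),
      by simpa [Function.update_of_ne (hcon a b hab)] using h2.2⟩
  have hij : j = i := by
    have := (hf a b hab).2
    rw [hfab] at this
    simpa using this.symm
  obtain ⟨a, b, hab, ha, hb⟩ : ∃ a b, H.Adj a b ∧ f a = w ∧ f b = z := by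
    rcases Sym2.eq_iff.1 hfab with ⟨h1, h2⟩ | ⟨h1, h2⟩
    · exact ⟨a, b, hab, h1, h2⟩
    · exact ⟨b, a, hab.symm, h2, h1⟩
  obtain ⟨d, had, hdb⟩ := hH.exists_adj_ne a b
  have hd := hf a d had
  have hne : s(f a, f d) ≠ s(w, z) := by
    rw [ha, ← hb]
    intro h
    rcases Sym2.eq_iff.1 h with ⟨-, h⟩ | ⟨-, h⟩
    · exact hdb (f.injective h)
    · exact had.ne (f.injective (ha.trans h.symm))
  refine ⟨f d, ha ▸ hother _ _ hd.1 hne, ?_⟩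
  have := hd.2
  rw [Function.update_of_ne hne, ha, hij] at this
  exact this

end

section

/-- A hypergraph with edges `E`, points `P` and uniformity `A` in which every incidence has a
potential vanishing at its point, at least `L` at the other points of its edge, and almost constant
on all other edges. This is a strong form of having girth greater than `L`. -/
def Sparse {P E A : Type} (inc : E → A → P) (L : ℕ) : Prop :=
  ∀ e a, ∃ U : P → ℕ, U (inc e a) = 0 ∧ (∀ a', a' ≠ a → L ≤ U (inc e a')) ∧
    ∀ e', e' ≠ e → ∀ a' a'', U (inc e' a') ≤ U (inc e' a'') + 1

lemma Sparse.exists_truncated {P E A : Type} {inc : E → A → P} {L : ℕ} (h : Sparse inc L)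
    (e : E) (a : A) : ∃ U : P → ℕ, U (inc e a) = 0 ∧ (∀ a', a' ≠ a → U (inc e a') = L) ∧
      (∀ e', e' ≠ e → ∀ a' a'', U (inc e' a') ≤ U (inc e' a'') + 1) ∧ ∀ p, U p ≤ L := by
  obtain ⟨U, h0, hL, hlip⟩ := h e a
  refine ⟨fun p => min (U p) L, by simp [h0], fun a' ha' => by simp [hL a' ha'],
    fun e' he' a' a'' => ?_, fun p => min_le_right _ _⟩
  have := hlip e' he' a' a''
  dsimp only
  omega

/-- The points of the amalgam that replaces, in copies of `P` indexed by `EN`, the points of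
class `i` by points of `incN`. -/
noncomputable def amalgam {P C PN EN : Type} (κ : P → C) (i : C)
    (incN : EN → {x // κ x = i} → PN) (n : EN) (y : P) : PN ⊕ EN × P :=
  open Classical in if h : κ y = i then .inl (incN n ⟨y, h⟩) else .inr (n, y)

lemma finset_sup_le_sup_add_one {X : Type} [Fintype X] (f g : X → ℕ) (h : ∀ x, f x ≤ g x + 1) :
    Finset.univ.sup f ≤ Finset.univ.sup g + 1 :=
  Finset.sup_le fun x _ => (h x).trans
    (Nat.add_le_add_right (Finset.le_sup (f := g) (Finset.mem_univ x)) 1)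

lemma Sparse.amalgam {P E A C PN EN : Type} [Finite P] {inc : E → A → P} {κ : P → C} {i : C}
    {incN : EN → {x // κ x = i} → PN} {t : E → (A ↪ C)} (ht : ∀ e a, κ (inc e a) = t e a)
    {L M : ℕ} (hM : M ≤ 2 * L) (hN : Sparse incN L) (h : Sparse inc M) :
    Sparse (fun (ne : EN × E) a => amalgam κ i incN ne.1 (inc ne.2 a)) M := by
  classical
  have := Fintype.ofFinite P
  rintro ⟨n, e⟩ a
  obtain ⟨U, hU0, hUM, hlip, hle⟩ := h.exists_truncated e a
  choose r hr0 hrL hrlip using fun x => hN n x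
  have hmid : ∀ x n', n' ≠ n → ∃ m, ∀ x', m ≤ r x (incN n' x') ∧ r x (incN n' x') ≤ m + 1 := by
    intro x n' hn'
    obtain ⟨x₀, hx₀⟩ : ∃ x₀, ∀ x', r x (incN n' x₀) ≤ r x (incN n' x') := by
      have : Nonempty {x // κ x = i} := ⟨x⟩
      exact Finite.exists_min _
    exact ⟨r x (incN n' x₀), fun x' => ⟨hx₀ x', hrlip x n' hn' _ _⟩⟩
  choose! m hm using hmid
  let D : PN ⊕ EN × P → ℕ := Sum.elim
    (fun p => Finset.univ.sup fun x : {x // κ x = i} => U x - 2 * r x p)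
    (fun p => if p.1 = n then U p.2 else
      Finset.univ.sup fun x : {x // κ x = i} => U x - (2 * m x p.1 + 1))
  have hDn : ∀ y, D (RamseySender.amalgam κ i incN n y) = U y := by
    intro y
    unfold RamseySender.amalgam
    split_ifs with hy
    · simp only [D, Sum.elim_inl]
      apply le_antisymm
      · refine Finset.sup_le fun x _ => ?_
        by_cases hxy : (⟨y, hy⟩ : {x // κ x = i}) = x
        · subst hxy; simp
        · have h1 := hrL x _ hxy
          have h2 := hle x
          omega
      · refine le_trans ?_ (Finset.le_sup (Finset.mem_univ (⟨y, hy⟩ : {x // κ x = i})))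
        simp [hr0]
    · simp [D]
  refine ⟨D, by rw [hDn, hU0], fun a' ha' => by rw [hDn, hUM a' ha'], ?_⟩
  rintro ⟨n', e'⟩ hne a' a''
  dsimp only
  by_cases hn : n' = n
  · subst hn
    rw [hDn, hDn]
    exact hlip e' (fun h => hne (h ▸ rfl)) _ _
  · by_cases haa : a' = a''
    · subst haa; omega
    by_cases h1 : κ (inc e' a') = i <;> by_cases h2 : κ (inc e' a'') = i
    · rw [ht] at h1 h2
      exact absurd ((t e').injective (h1.trans h2.symm)) haa
    · simp only [D, RamseySender.amalgam, dif_pos h1, dif_neg h2, Sum.elim_inl, Sum.elim_inr,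
        if_neg hn]
      refine finset_sup_le_sup_add_one _ _ fun x => ?_
      have := hm x n' hn ⟨_, h1⟩
      omega
    · simp only [D, RamseySender.amalgam, dif_neg h1, dif_pos h2, Sum.elim_inl, Sum.elim_inr,
        if_neg hn]
      refine finset_sup_le_sup_add_one _ _ fun x => ?_
      have := hm x n' hn ⟨_, h2⟩
      omega
    · simp only [D, RamseySender.amalgam, dif_neg h1, dif_neg h2, Sum.elim_inr, if_neg hn]
      omega

lemma exists_embedding_fiber {q : ℕ} {A : Type} [Finite A] {P : Type} [Fintype P]
    (hq : 0 < q) (hP : q * Nat.card A < Fintype.card P) (c : P → Fin q) :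
    ∃ (e : A ↪ P) (i : Fin q), ∀ a, c (e a) = i := by
  classical
  have := Fintype.ofFinite A
  have : Nonempty (Fin q) := ⟨⟨0, hq⟩⟩
  obtain ⟨i, hi⟩ := Fintype.exists_lt_card_fiber_of_mul_lt_card c (n := Nat.card A)
    (by simpa using hP)
  obtain ⟨e⟩ : Nonempty (A ↪ {x // x ∈ Finset.univ.filter fun x => c x = i}) :=
    Function.Embedding.nonempty_of_card_le (by
      rw [Fintype.card_coe, ← Nat.card_eq_fintype_card]; exact hi.le)
  exact ⟨e.trans (Function.Embedding.subtype _), i, fun a => (Finset.mem_filter.1 (e a).2).2⟩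

lemma exists_sparse_partite {q : ℕ} {L M : ℕ} (hM : M ≤ 2 * L)
    (ih : ∀ (A : Type) [Finite A], ∃ (P E : Type) (_ : Finite P) (_ : Finite E) (inc : E → A → P),
      Sparse inc L ∧ ∀ c : P → Fin q, ∃ e i, ∀ a, c (inc e a) = i)
    (hq : 0 < q) (A C : Type) [Finite A] [Finite C] (S : Finset C) :
    ∃ (P E : Type) (_ : Finite P) (_ : Finite E) (inc : E → A → P) (κ : P → C) (t : E → (A ↪ C)),
      (∀ e a, κ (inc e a) = t e a) ∧ Sparse inc M ∧
      ∀ c : P → Fin q, ∃ γ : C → Fin q, ∀ τ : A ↪ C,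
        ∃ e, t e = τ ∧ ∀ a, τ a ∈ S → c (inc e a) = γ (τ a) := by
  classical
  induction S using Finset.induction_on with
  | empty =>
    refine ⟨(A ↪ C) × A, A ↪ C, inferInstance, inferInstance, fun e a => (e, a), fun p => p.1 p.2,
      fun e => e, fun e a => rfl, fun e a => ?_, fun c => ⟨fun _ => ⟨0, hq⟩, fun τ => ⟨τ, by simp⟩⟩⟩
    refine ⟨fun p => if p.1 = e ∧ p.2 ≠ a then M else 0, by simp, fun a' ha' => by simp [ha'],
      fun e' he' a' a'' => by simp [he']⟩
  | insert i S hi hS =>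
    obtain ⟨P, E, _, _, inc, κ, t, ht, hsp, hgood⟩ := hS
    obtain ⟨PN, EN, _, _, incN, hspN, hN⟩ := ih {x // κ x = i}
    refine ⟨PN ⊕ EN × P, EN × E, inferInstance, inferInstance,
      fun ne a => amalgam κ i incN ne.1 (inc ne.2 a), Sum.elim (fun _ => i) (fun p => κ p.2),
      fun ne => t ne.2, ?_, Sparse.amalgam ht hM hspN hsp, ?_⟩
    · rintro ⟨n, e⟩ a
      dsimp only [amalgam]
      split_ifs with h
      · simp [← ht, h]
      · simp [ht]
    · intro c
      obtain ⟨n, j, hn⟩ := hN (fun p => c (.inl p))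
      obtain ⟨γ, hγ⟩ := hgood (fun y => c (amalgam κ i incN n y))
      refine ⟨Function.update γ i j, fun τ => ?_⟩
      obtain ⟨e, he, hea⟩ := hγ τ
      refine ⟨(n, e), he, fun a ha => ?_⟩
      by_cases hτ : τ a = i
      · have h : κ (inc e a) = i := by rw [ht, he, hτ]
        simp only [amalgam, dif_pos h, hn, hτ, Function.update_self]
      · rw [Function.update_of_ne hτ]
        exact hea a ((Finset.mem_insert.1 ha).resolve_left hτ)

/-- There are finite uniform hypergraphs of large chromatic number that are sparse. -/
lemma exists_sparse {q : ℕ} (hq : 0 < q) (L : ℕ) (hL : 1 ≤ L) : ∀ (A : Type) [Finite A],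
    ∃ (P E : Type) (_ : Finite P) (_ : Finite E) (inc : E → A → P),
      Sparse inc L ∧ ∀ c : P → Fin q, ∃ e i, ∀ a, c (inc e a) = i := by
  classical
  induction L, hL using Nat.le_induction with
  | base =>
    intro A _
    refine ⟨Fin (q * Nat.card A + 1), A ↪ Fin (q * Nat.card A + 1), inferInstance, inferInstance,
      fun e a => e a, fun e a => ?_, fun c => exists_embedding_fiber hq (by simp) c⟩
    refine ⟨fun p => if p = e a then 0 else 1, by simp, fun a' ha' => by simp [ha'],
      fun e' _ a' a'' => ?_⟩
    dsimp only
    split_ifs <;> omega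
  | succ L hL ih =>
    intro A _
    obtain ⟨P, E, _, _, inc, κ, t, ht, hsp, hgood⟩ := exists_sparse_partite
      (show L + 1 ≤ 2 * L by omega) ih hq A (Fin (q * Nat.card A + 1)) Finset.univ
    refine ⟨P, E, inferInstance, inferInstance, inc, hsp, fun c => ?_⟩
    obtain ⟨γ, hγ⟩ := hgood c
    obtain ⟨τ, i, hτ⟩ := exists_embedding_fiber (A := A) hq (by simp) γ
    obtain ⟨e, -, he⟩ := hγ τ
    exact ⟨e, i, fun a => (he a (Finset.mem_univ _)).trans (hτ a)⟩

end

section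

variable {W : Type} [Fintype W] {H : SimpleGraph W} {q : ℕ}

/-- A union of at most two vertices of the host graph does not separate a copy of `H`. -/
lemma Robust.closed_image (hH : Robust H) {V : Type} (f : W ↪ V) (u v : V) {C : Set W}
    (hC : C.Nonempty) (huv : ∀ a ∈ C, f a ≠ u ∧ f a ≠ v)
    (hcl : ∀ a ∈ C, ∀ b, H.Adj a b → b ∈ C ∨ f b = u ∨ f b = v) (b : W) :
    b ∈ C ∨ f b = u ∨ f b = v := by
  by_cases hu : ∃ x, f x = u <;> by_cases hv : ∃ y, f y = v
  · obtain ⟨x, rfl⟩ := hu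
    obtain ⟨y, rfl⟩ := hv
    simpa using hH.closed x y C hC (fun h => (huv x h).1 rfl) (fun h => (huv y h).2 rfl)
      (by simpa using hcl) b
  · obtain ⟨x, rfl⟩ := hu
    push Not at hv
    simpa [hv] using hH.closed x x C hC (fun h => (huv x h).1 rfl) (fun h => (huv x h).1 rfl)
      (by simpa [hv] using hcl) b
  · obtain ⟨y, rfl⟩ := hv
    push Not at hu
    simpa [hu] using hH.closed y y C hC (fun h => (huv y h).2 rfl) (fun h => (huv y h).2 rfl)
      (by simpa [hu] using hcl) b
  · push Not at hu hv
    simp only [hu, hv, or_false] at hcl ⊢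
    by_contra hb
    have h := hH.closed b b C hC hb hb (fun a ha d had => Or.inl (hcl a ha d had))
    obtain ⟨d, hd, hdb⟩ := hH.exists_adj_ne b b
    rcases h d with h | h | h
    · exact hb (hcl d h b hd.symm)
    · exact hdb h
    · exact hdb h

lemma exists_missed_level {V : Type} (f : W → V) (d : V → ℕ) (m : ℕ) :
    ∃ l, m ≤ l ∧ l ≤ m + Fintype.card W ∧ ∀ a, d (f a) ≠ l := by
  classical
  by_contra! hcon
  have hsub : Finset.Icc m (m + Fintype.card W) ⊆ Finset.univ.image fun a => d (f a) := by
    intro l hl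
    obtain ⟨h1, h2⟩ := Finset.mem_Icc.1 hl
    obtain ⟨a, ha⟩ := hcon l h1 h2
    exact Finset.mem_image.2 ⟨a, Finset.mem_univ _, ha⟩
  have h1 := (Finset.card_le_card hsub).trans Finset.card_image_le
  simp at h1
  omega

/-- Moving edges from `y` to a distant vertex `p` with `w y`, `w p` of equal colour preserves the
existence of a colouring without monochromatic copies. -/
lemma not_isRamsey_of_merge (hH : Robust H) {V : Type} {G G' : SimpleGraph V} {w y p : V}
    {d : V → ℕ} (hwp : w ≠ p)
    (hd : ∀ u v, G.Adj u v → u ≠ w → v ≠ w → d v ≤ d u + 1)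
    (hdy : d y = 0) (hdp : Fintype.card W + 4 ≤ d p) (hwy : G.Adj w y) (hwpG : G.Adj w p)
    (hG' : ∀ u v, G'.Adj u v → u ≠ y ∧ v ≠ y ∧
      (G.Adj u v ∨ (u = p ∧ G.Adj y v) ∨ (v = p ∧ G.Adj u y)))
    {c : Sym2 V → Fin q} (hc : HFree H G c) (hcc : c s(w, y) = c s(w, p)) :
    ¬ IsRamsey q G' H := by
  classical
  intro hram
  let φ : V → V := fun v => if v = p then y else v
  obtain ⟨i, f, hf'⟩ := hram fun e => if e ∈ G.edgeSet then c e else c (e.map φ)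
  have hf : ∀ a b, H.Adj a b → G'.Adj (f a) (f b) ∧
      (if s(f a, f b) ∈ G.edgeSet then c s(f a, f b) else c s(φ (f a), φ (f b))) = i :=
    fun a b hab => hf' a b hab
  obtain ⟨l, hl2, hlh, hl⟩ := exists_missed_level f d 2
  have hfy : ∀ a, f a ≠ y := fun a => by
    obtain ⟨b, hb, -⟩ := hH.exists_adj_ne a a
    exact (hG' _ _ (hf a b hb).1).1
  let C : Set W := {a | f a ≠ w ∧ f a ≠ p ∧ d (f a) < l}
  by_cases hC : C.Nonempty
  · have hall : ∀ b, b ∈ C ∨ f b = w ∨ f b = p := by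
      refine hH.closed_image f w p hC (fun a ha => ⟨ha.1, ha.2.1⟩) fun a ha b hab => ?_
      by_contra! hb
      obtain ⟨hbC, hbw, hbp⟩ := hb
      obtain ⟨-, -, h | h | h⟩ := hG' _ _ (hf a b hab).1
      · refine hbC ⟨hbw, hbp, ?_⟩
        have h1 := hd _ _ h ha.1 hbw
        have h2 := hl b
        have h3 := ha.2.2
        omega
      · exact ha.2.1 h.1
      · exact hbp h.1
    have hp : ∀ a b, H.Adj a b → f a = p → G.Adj y (f b) ∧ c s(y, f b) = i := by
      intro a b hab hap
      obtain ⟨hadj, hcol⟩ := hf a b hab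
      have hbp : f b ≠ p := hap ▸ hadj.ne'
      rw [hap] at hadj hcol
      by_cases hG : G.Adj p (f b)
      · have hbw : f b = w := by
          rcases hall b with h | h | h
          · have h1 := hd _ _ hG.symm h.1 hwp.symm
            have h2 := h.2.2
            omega
          · exact h
          · exact absurd h hbp
        rw [if_pos (by simpa using hG)] at hcol
        rw [hbw] at hcol ⊢
        exact ⟨hwy.symm, by rw [← hcol, Sym2.eq_swap, hcc, Sym2.eq_swap]⟩
      · rw [if_neg (by simpa using hG)] at hcol
        obtain ⟨-, -, h | h | h⟩ := hG' _ _ hadj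
        · exact absurd h hG
        · exact ⟨h.2, by simpa [φ, hbp] using hcol⟩
        · exact absurd h.1 hbp
    have hinj : Function.Injective fun a => φ (f a) := by
      intro a b hab
      by_cases ha : f a = p <;> by_cases hb : f b = p
      · exact f.injective (ha.trans hb.symm)
      · simp only [φ, if_pos ha, if_neg hb] at hab
        exact absurd hab.symm (hfy b)
      · simp only [φ, if_neg ha, if_pos hb] at hab
        exact absurd hab (hfy a)
      · simp only [φ, if_neg ha, if_neg hb] at hab
        exact f.injective hab
    refine hc ⟨i, ⟨_, hinj⟩, fun a b hab => ?_⟩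
    by_cases ha : f a = p <;> by_cases hb : f b = p
    · exact absurd (f.injective (ha.trans hb.symm)) hab.ne
    · simpa [φ, ha, hb] using hp a b hab ha
    · have := hp b a hab.symm hb
      rw [Sym2.eq_swap] at this
      simpa [φ, ha, hb] using ⟨this.1.symm, this.2⟩
    · obtain ⟨hadj, hcol⟩ := hf a b hab
      obtain ⟨-, -, h | h | h⟩ := hG' _ _ hadj
      · rw [if_pos (by simpa using h)] at hcol
        simpa [φ, ha, hb] using ⟨h, hcol⟩
      · exact absurd h.1 ha
      · exact absurd h.1 hb
  · have hhigh : ∀ a, f a = w ∨ f a = p ∨ 2 ≤ d (f a) := by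
      intro a
      by_contra! h
      exact hC ⟨a, h.1, h.2.1, by omega⟩
    have hpG : ∀ b, f b ≠ p → G.Adj y (f b) → G.Adj p (f b) := by
      intro b hb h
      rcases hhigh b with h1 | h1 | h1
      · rw [h1]; exact hwpG.symm
      · exact absurd h1 hb
      · by_cases hbw : f b = w
        · rw [hbw]; exact hwpG.symm
        · have := hd _ _ h hwy.ne' hbw
          omega
    refine hc ⟨i, f, fun a b hab => ?_⟩
    obtain ⟨hadj, hcol⟩ := hf a b hab
    have hG : G.Adj (f a) (f b) := by
      obtain ⟨-, -, h | ⟨h1, h2⟩ | ⟨h1, h2⟩⟩ := hG' _ _ hadj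
      · exact h
      · rw [h1]
        exact hpG b (h1 ▸ hadj.ne') h2
      · rw [h1]
        exact (hpG a (h1 ▸ hadj.ne) h2.symm).symm
    exact ⟨hG, by simpa [hG] using hcol⟩

section hub

variable {P E VB : Type} (B : SimpleGraph VB) (w : VB) (inc : E → {a // B.Adj w a} → P)

open Classical in
/-- The position of the vertices of the copies of `B`: all copies share the vertex `w`, and the
incidences in `S` are moved to the points of the hypergraph. -/
noncomputable def hubMap (S : Set (E × {a // B.Adj w a})) (e : E) (v : VB) : (E × VB) ⊕ Option P :=
  if v = w then .inr none
  else if h : ∃ h : B.Adj w v, (e, ⟨v, h⟩) ∈ S then .inr (some (inc e ⟨v, h.1⟩)) else .inl (e, v)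

/-- The union of the copies of `B` placed according to `hubMap`, and of all edges from the common
vertex to the points of the hypergraph. -/
def hubGraph (S : Set (E × {a // B.Adj w a})) : SimpleGraph ((E × VB) ⊕ Option P) where
  Adj u v := u ≠ v ∧ ((∃ e a b, B.Adj a b ∧ hubMap B w inc S e a = u ∧ hubMap B w inc S e b = v) ∨
    (u = .inr none ∧ ∃ p, v = .inr (some p)) ∨ (v = .inr none ∧ ∃ p, u = .inr (some p)))
  symm := ⟨by
    rintro u v ⟨hne, ⟨e, a, b, hab, ha, hb⟩ | h | h⟩
    · exact ⟨hne.symm, Or.inl ⟨e, b, a, hab.symm, hb, ha⟩⟩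
    · exact ⟨hne.symm, Or.inr (Or.inr h)⟩
    · exact ⟨hne.symm, Or.inr (Or.inl h)⟩⟩
  loopless := ⟨fun u h => h.1 rfl⟩

variable {B w inc}

lemma hubMap_self (S : Set (E × {a // B.Adj w a})) (e : E) :
    hubMap B w inc S e w = .inr none := by
  simp [hubMap]

lemma hubMap_empty (e : E) {v : VB} (hv : v ≠ w) :
    hubMap B w inc ∅ e v = .inl (e, v) := by
  simp [hubMap, hv]

lemma hubMap_of_mem {S : Set (E × {a // B.Adj w a})} {e : E} {a : {a // B.Adj w a}}
    (h : (e, a) ∈ S) : hubMap B w inc S e a = .inr (some (inc e a)) := by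
  have h1 : (a : VB) ≠ w := a.2.ne'
  have h2 : ∃ h : B.Adj w a, (e, ⟨a, h⟩) ∈ S := ⟨a.2, h⟩
  simp only [hubMap, if_neg h1, dif_pos h2]

lemma hubMap_of_notMem {S : Set (E × {a // B.Adj w a})} {e : E} {a : {a // B.Adj w a}}
    (h : (e, a) ∉ S) : hubMap B w inc S e a = .inl (e, (a : VB)) := by
  have h1 : (a : VB) ≠ w := a.2.ne'
  have h2 : ¬ ∃ h : B.Adj w a, (e, ⟨a, h⟩) ∈ S := fun ⟨_, h'⟩ => h h'
  simp only [hubMap, if_neg h1, dif_neg h2]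

lemma hubMap_cases (S : Set (E × {a // B.Adj w a})) (e : E) (v : VB) :
    (v = w ∧ hubMap B w inc S e v = .inr none) ∨
    (∃ a : {a // B.Adj w a}, v = a ∧ (e, a) ∈ S ∧
      hubMap B w inc S e v = .inr (some (inc e a))) ∨
    hubMap B w inc S e v = .inl (e, v) := by
  unfold hubMap
  split_ifs with h1 h2
  · exact Or.inl ⟨h1, rfl⟩
  · exact Or.inr (Or.inl ⟨⟨v, h2.1⟩, rfl, h2.2, rfl⟩)
  · exact Or.inr (Or.inr rfl)

lemma hubMap_injective {S : Set (E × {a // B.Adj w a})} {e : E}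
    (he : Function.Injective (inc e)) : Function.Injective (hubMap B w inc S e) := by
  intro u v huv
  rcases hubMap_cases (inc := inc) S e u with ⟨h1, h2⟩ | ⟨a, h1, -, h2⟩ | h2 <;>
    rcases hubMap_cases (inc := inc) S e v with ⟨h3, h4⟩ | ⟨b, h3, -, h4⟩ | h4 <;>
    rw [h2, h4] at huv <;> simp_all
  exact congrArg Subtype.val (he huv)

lemma not_isRamsey_hubGraph_empty (hH : Robust H) (hB : ¬ IsRamsey q B H) :
    ¬ IsRamsey q (hubGraph B w inc ∅) H := by
  obtain ⟨c, hc⟩ := not_isRamsey_iff.1 hB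
  let τ : (E × VB) ⊕ Option P → VB := Sum.elim Prod.snd fun _ => w
  have hτ : ∀ e v, τ (hubMap B w inc ∅ e v) = v := by
    intro e v
    by_cases hv : v = w
    · subst hv; simp [hubMap_self, τ]
    · simp [hubMap_empty e hv, τ]
  intro hram
  obtain ⟨i, f, hf⟩ := hram (c ∘ Sym2.map τ)
  have hedge : ∀ a b, H.Adj a b → ∃ e u v, B.Adj u v ∧ hubMap B w inc ∅ e u = f a ∧
      hubMap B w inc ∅ e v = f b := by
    have hpt : ∀ a p, f a ≠ .inr (some p) := by
      intro a p ha
      obtain ⟨b, -, hadj, hb⟩ := hH.exists_adj_image_ne (fun a b h => (hf a b h).1) a (.inr none)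
      rcases hadj.2 with ⟨e, u, v, -, hu, -⟩ | h | h
      · rw [ha] at hu
        by_cases huw : u = w
        · subst huw; simp [hubMap_self] at hu
        · simp [hubMap_empty e huw] at hu
      · rw [ha] at h; simpa using h.1
      · exact hb h.1
    intro a b hab
    rcases (hf a b hab).1.2 with h | ⟨-, p, hp⟩ | ⟨-, p, hp⟩
    · exact h
    · exact absurd hp (hpt b p)
    · exact absurd hp (hpt a p)
  obtain ⟨e, hall⟩ : ∃ e, ∀ a, ∃ v, f a = hubMap B w inc ∅ e v := by
    obtain ⟨a₀⟩ := hH.nonempty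
    obtain ⟨a₁, ha₁, e, v, hv, hvw⟩ :
        ∃ a₁, f a₁ ≠ .inr none ∧ ∃ e v, hubMap B w inc ∅ e v = f a₁ ∧ v ≠ w := by
      obtain ⟨a₁, h₁, -, hne⟩ :=
        hH.exists_adj_image_ne (fun a b h => (hf a b h).1) a₀ (.inr none)
      obtain ⟨e, u, v, -, -, hv⟩ := hedge a₀ a₁ h₁
      refine ⟨a₁, hne, e, v, hv, ?_⟩
      rintro rfl
      exact hne (by rw [← hv, hubMap_self])
    refine ⟨e, fun b => ?_⟩
    have := hH.closed_image f (.inr none) (.inr none) (C := {a | ∃ v, v ≠ w ∧ f a = .inl (e, v)})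
      ⟨a₁, v, hvw, by rw [← hv, hubMap_empty e hvw]⟩
      (by rintro a ⟨v, -, h⟩; simp [h]) (by
        rintro a ⟨v, hvw, hav⟩ b hab
        obtain ⟨e', u', v', -, hu, hv''⟩ := hedge a b hab
        rw [hav] at hu
        by_cases hu' : u' = w
        · subst hu'; simp [hubMap_self] at hu
        rw [hubMap_empty e' hu'] at hu
        obtain ⟨rfl, rfl⟩ : e' = e ∧ u' = v := by simpa using hu
        by_cases hv' : v' = w
        · subst hv'; exact Or.inr (Or.inl (by rw [← hv'', hubMap_self]))
        · exact Or.inl ⟨v', hv', by rw [← hv'', hubMap_empty e' hv']⟩) b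
    rcases this with ⟨v, hv, h⟩ | h | h
    · exact ⟨v, by rw [h, hubMap_empty e hv]⟩
    · exact ⟨w, by rw [h, hubMap_self]⟩
    · exact ⟨w, by rw [h, hubMap_self]⟩
  refine hc ⟨i, ⟨fun a => τ (f a), fun a b hab => ?_⟩, fun a b hab => ⟨?_, ?_⟩⟩
  · obtain ⟨u, hu⟩ := hall a
    obtain ⟨v, hv⟩ := hall b
    dsimp only at hab
    rw [hu, hv, hτ, hτ] at hab
    exact f.injective (by rw [hu, hv, hab])
  · obtain ⟨e', u, v, huv, hu, hv⟩ := hedge a b hab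
    change B.Adj (τ (f a)) (τ (f b))
    simpa [← hu, ← hv, hτ] using huv
  · exact (hf a b hab).2

lemma isRamsey_hubGraph_univ (hq : 2 ≤ q) (hinj : ∀ e, Function.Injective (inc e))
    (hB : ∀ c : Sym2 VB → Fin q, HFree H B c → ∀ i, ∃ a, B.Adj w a ∧ c s(w, a) = i)
    (hinc : ∀ c : P → Fin q, ∃ e i, ∀ a, c (inc e a) = i) :
    IsRamsey q (hubGraph B w inc Set.univ) H := by
  by_contra hcon
  obtain ⟨c, hc⟩ := not_isRamsey_iff.1 hcon
  obtain ⟨e, i, he⟩ := hinc fun p => c s(.inr none, .inr (some p))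
  have : Nontrivial (Fin q) := Fin.nontrivial_iff_two_le.2 hq
  obtain ⟨j, hj⟩ := exists_ne i
  have hinje := hubMap_injective (S := Set.univ) (hinj e)
  obtain ⟨a, ha, haj⟩ := hB _ (HFree.comap (G := B) (G' := hubGraph B w inc Set.univ)
    (hubMap B w inc Set.univ e) hinje (c := c) (h := hc)
    (hadj := fun u v huv => ⟨fun h => huv.ne (hinje h), Or.inl ⟨e, u, v, huv, rfl, rfl⟩⟩)) j
  have := he ⟨a, ha⟩
  rw [← hubMap_of_mem (S := Set.univ) (Set.mem_univ _)] at this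
  simp only [Function.comp_apply, Sym2.map_mk, hubMap_self] at haj
  exact hj (haj.symm.trans this)

end hub

/-- There is a graph with two edges `w y` and `w p` that always receive different colours, and in
which `y` and `p` are far apart outside `w`. -/
lemma exists_apex_gadget (hH : Robust H) (hq : 2 ≤ q) :
    ∃ (V : Type) (_ : Finite V) (G : SimpleGraph V) (w y p : V) (d : V → ℕ),
      (∀ u v, G.Adj u v → u ≠ w → v ≠ w → d v ≤ d u + 1) ∧ d y = 0 ∧
      Fintype.card W + 4 ≤ d p ∧ G.Adj w y ∧ G.Adj w p ∧ ¬ IsRamsey q G H ∧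
      ∀ c : Sym2 V → Fin q, HFree H G c → c s(w, y) ≠ c s(w, p) := by
  classical
  obtain ⟨VB, _, B, w, hB, hstar⟩ := exists_rainbow_vertex (q := q) hH (by omega)
  obtain ⟨P, E, _, _, inc, hsp, hinc⟩ := exists_sparse (q := q) (by omega)
    (Fintype.card W + 4) (by omega) {a // B.Adj w a}
  have hinj : ∀ e, Function.Injective (inc e) := by
    intro e a a' h
    by_contra hne
    obtain ⟨U, h0, hL, -⟩ := hsp e a
    have := hL a' (Ne.symm hne)
    rw [← h] at this
    omega
  obtain ⟨S, hS⟩ := (Set.toFinite {S : Set (E × {a // B.Adj w a}) |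
    ¬ IsRamsey q (hubGraph B w inc S) H}).exists_maximal ⟨∅, not_isRamsey_hubGraph_empty hH hB⟩
  have hSR : ¬ IsRamsey q (hubGraph B w inc S) H := hS.1
  obtain ⟨e, a, hea⟩ : ∃ e a, (e, a) ∉ S := by
    by_contra! hcon
    refine hSR ?_
    rw [show S = Set.univ from Set.eq_univ_of_forall fun x => hcon x.1 x.2]
    exact isRamsey_hubGraph_univ hq hinj hstar hinc
  have hram : IsRamsey q (hubGraph B w inc (insert (e, a) S)) H := by
    by_contra hcon
    exact hea (hS.2 hcon (Set.subset_insert _ _) (Set.mem_insert _ _))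
  obtain ⟨U, hU0, hUL, hlip, hle⟩ := hsp.exists_truncated e a
  have hb : ∀ e', e' ≠ e → ∃ b, ∀ a', b ≤ Fintype.card W + 4 - U (inc e' a') ∧
      Fintype.card W + 4 - U (inc e' a') ≤ b + 1 := by
    intro e' he'
    have : Nonempty {a // B.Adj w a} := ⟨a⟩
    obtain ⟨x, hx⟩ := Finite.exists_max fun a' => U (inc e' a')
    refine ⟨Fintype.card W + 4 - U (inc e' x), fun a' => ?_⟩
    have h1 := hx a'
    have h2 := hlip e' he' x a'
    omega
  choose! b hb using hb
  let d : (E × VB) ⊕ Option P → ℕ := Sum.elim (fun x => if x.1 = e then 0 else b x.1)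
    (fun p => p.elim 0 fun p => Fintype.card W + 4 - U p)
  have hmap : ∀ e' v, hubMap B w inc S e' v ≠ .inr none →
      (e' = e → d (hubMap B w inc S e' v) = 0) ∧
      (e' ≠ e → b e' ≤ d (hubMap B w inc S e' v) ∧ d (hubMap B w inc S e' v) ≤ b e' + 1) := by
    intro e' v hv
    rcases hubMap_cases (inc := inc) S e' v with ⟨-, h⟩ | ⟨a', -, hS', h⟩ | h
    · exact absurd h hv
    · rw [h]
      refine ⟨fun he => ?_, fun he => hb e' he a'⟩
      subst he
      have : a' ≠ a := fun h => hea (h ▸ hS')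
      simp [d, hUL a' this]
    · rw [h]
      refine ⟨fun he => by simp [d, he], fun he => by simp [d, he]⟩
  have hd : ∀ u v, (hubGraph B w inc S).Adj u v → u ≠ .inr none → v ≠ .inr none →
      d v ≤ d u + 1 := by
    rintro u v ⟨-, ⟨e', x, y, -, rfl, rfl⟩ | h | h⟩ hu hv
    · have h1 := hmap e' x hu
      have h2 := hmap e' y hv
      by_cases he : e' = e
      · rw [h2.1 he]; omega
      · have h3 := h1.2 he
        have h4 := h2.2 he
        omega
    · exact absurd h.1 hu
    · exact absurd h.1 hv
  have hwy : (hubGraph B w inc S).Adj (.inr none) (.inl (e, (a : VB))) :=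
    ⟨by simp, Or.inl ⟨e, w, a, a.2, hubMap_self _ _, hubMap_of_notMem hea⟩⟩
  have hwp : (hubGraph B w inc S).Adj (.inr none) (.inr (some (inc e a))) :=
    ⟨by simp, Or.inr (Or.inl ⟨rfl, _, rfl⟩)⟩
  have hdp : Fintype.card W + 4 ≤ d (.inr (some (inc e a))) := by simp [d, hU0]
  refine ⟨_, inferInstance, hubGraph B w inc S, .inr none, .inl (e, (a : VB)),
    .inr (some (inc e a)), d, hd, by simp [d], hdp, hwy, hwp, hSR, fun c hc hcc => ?_⟩
  refine not_isRamsey_of_merge hH (by simp) hd (by simp [d]) hdp hwy hwp ?_ hc hcc hram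
  have hins : ∀ e' v, (hubMap B w inc S e' v = .inl (e, (a : VB)) ∧
      hubMap B w inc (insert (e, a) S) e' v = .inr (some (inc e a))) ∨
      (hubMap B w inc S e' v ≠ .inl (e, (a : VB)) ∧
      hubMap B w inc (insert (e, a) S) e' v = hubMap B w inc S e' v) := by
    intro e' v
    by_cases hv : v = w
    · subst hv; right; simp [hubMap_self]
    by_cases hadj : B.Adj w v
    · lift v to {a // B.Adj w a} using hadj
      by_cases hS' : (e', v) ∈ S
      · right
        rw [hubMap_of_mem hS', hubMap_of_mem (Set.mem_insert_of_mem _ hS')]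
        simp
      · rw [hubMap_of_notMem hS']
        by_cases heq : (e', v) = (e, a)
        · obtain ⟨rfl, rfl⟩ := Prod.mk.inj heq
          exact Or.inl ⟨rfl, hubMap_of_mem (Set.mem_insert _ _)⟩
        · right
          refine ⟨fun h => heq ?_, hubMap_of_notMem (by simp_all)⟩
          simpa [Subtype.ext_iff] using h
    · have h1 : ∀ S, hubMap B w inc S e' v = .inl (e', v) := fun S => by simp [hubMap, hv, hadj]
      right
      rw [h1, h1]
      refine ⟨fun h => hadj ?_, rfl⟩
      obtain ⟨-, rfl⟩ : e' = e ∧ v = a := by simpa using h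
      exact a.2
  rintro u v ⟨hne, ⟨e', x, y, hxy, rfl, rfl⟩ | ⟨rfl, p, rfl⟩ | ⟨rfl, p, rfl⟩⟩
  · rcases hins e' x with ⟨h1, h2⟩ | ⟨h1, h2⟩ <;> rcases hins e' y with ⟨h3, h4⟩ | ⟨h3, h4⟩
    · rw [h2, h4] at hne; exact absurd rfl hne
    · rw [h2, h4]
      exact ⟨by simp, h3, Or.inr (Or.inl ⟨rfl, h3.symm, Or.inl ⟨e', x, y, hxy, h1, rfl⟩⟩)⟩
    · rw [h2, h4]
      exact ⟨h1, by simp, Or.inr (Or.inr ⟨rfl, h1, Or.inl ⟨e', x, y, hxy, rfl, h3⟩⟩)⟩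
    · rw [h2, h4] at hne ⊢
      exact ⟨h1, h3, Or.inl ⟨hne, Or.inl ⟨e', x, y, hxy, rfl, rfl⟩⟩⟩
  · exact ⟨by simp, by simp, Or.inl ⟨hne, Or.inr (Or.inl ⟨rfl, p, rfl⟩)⟩⟩
  · exact ⟨by simp, by simp, Or.inl ⟨hne, Or.inr (Or.inr ⟨rfl, p, rfl⟩)⟩⟩

end

section

variable {W : Type} [Fintype W]

/-- A finite graph with two distinguished edges `e₀ e₁` and `f₀ f₁` whose colours, in colourings
without monochromatic copies of `H`, are always equal if `sgn` is true and always different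
otherwise, and are subject to no other constraint. The potential `d` keeps the two edges apart. -/
structure Gadget (H : SimpleGraph W) (q : ℕ) where
  S : Type
  finite : Finite S
  G : SimpleGraph S
  (e₀ e₁ f₀ f₁ : S)
  d : S → ℕ
  sgn : Bool
  adj_e : G.Adj e₀ e₁
  adj_f : G.Adj f₀ f₁
  lip : ∀ s t, s ∉ ({e₀, e₁, f₀, f₁} : Set S) → t ∉ ({e₀, e₁, f₀, f₁} : Set S) → G.Adj s t →
    d t ≤ d s + 1
  near : ∀ s t, s ∉ ({e₀, e₁, f₀, f₁} : Set S) → t ∈ ({e₀, e₁, f₀, f₁} : Set S) → G.Adj s t →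
    ((t = e₀ ∨ t = e₁) ∨ Fintype.card W + 1 < d s) ∧ ((t = f₀ ∨ t = f₁) ∨ d s ≤ 1)
  terminal_adj : ∀ s t, s ∈ ({e₀, e₁, f₀, f₁} : Set S) → t ∈ ({e₀, e₁, f₀, f₁} : Set S) →
    G.Adj s t → s(s, t) = s(e₀, e₁) ∨ s(s, t) = s(f₀, f₁)
  sound : ∀ c : Sym2 S → Fin q, HFree H G c → (c s(e₀, e₁) = c s(f₀, f₁) ↔ sgn = true)
  complete : ∀ x y : Fin q, (x = y ↔ sgn = true) →
    ∃ c : Sym2 S → Fin q, HFree H G c ∧ c s(e₀, e₁) = x ∧ c s(f₀, f₁) = y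

variable {H : SimpleGraph W} {q : ℕ}

/-- The terminals of a gadget. -/
def Gadget.terminals (g : Gadget H q) : Set g.S := {g.e₀, g.e₁, g.f₀, g.f₁}

/-- Gadgets to be glued onto the edges of a graph. -/
structure Gluing {V : Type} (X : SimpleGraph V) (H : SimpleGraph W) (q : ℕ) (J : Type) where
  g : J → Gadget H q
  ι : ∀ j, (g j).S → V
  injOn : ∀ j, Set.InjOn (ι j) (g j).terminals
  adj_e : ∀ j, X.Adj (ι j (g j).e₀) (ι j (g j).e₁)
  adj_f : ∀ j, X.Adj (ι j (g j).f₀) (ι j (g j).f₁)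

namespace Gluing

variable {V J : Type} {X : SimpleGraph V} (Γ : Gluing X H q J)

/-- The vertices of the glued graph: those of the base graph and those of the gadgets (the
terminals of the gadgets being replaced by vertices of the base graph). -/
abbrev Vert : Type := V ⊕ Σ j, (Γ.g j).S

open Classical in
/-- The position of the vertices of a gadget in the glued graph. -/
noncomputable def emb (j : J) (s : (Γ.g j).S) : Γ.Vert :=
  if s ∈ (Γ.g j).terminals then .inl (Γ.ι j s) else .inr ⟨j, s⟩

lemma emb_of_mem {j : J} {s : (Γ.g j).S} (h : s ∈ (Γ.g j).terminals) :
    Γ.emb j s = .inl (Γ.ι j s) := if_pos h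

lemma emb_of_notMem {j : J} {s : (Γ.g j).S} (h : s ∉ (Γ.g j).terminals) :
    Γ.emb j s = .inr ⟨j, s⟩ := if_neg h

lemma emb_injective (j : J) : Function.Injective (Γ.emb j) := by
  intro s t h
  by_cases hs : s ∈ (Γ.g j).terminals <;> by_cases ht : t ∈ (Γ.g j).terminals
  · rw [emb_of_mem _ hs, emb_of_mem _ ht] at h
    exact Γ.injOn j hs ht (Sum.inl_injective h)
  · simp [emb_of_mem _ hs, emb_of_notMem _ ht] at h
  · simp [emb_of_mem _ ht, emb_of_notMem _ hs] at h
  · simpa [emb_of_notMem _ ht, emb_of_notMem _ hs] using h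

lemma emb_eq_inr {j k : J} {s : (Γ.g j).S} {t : (Γ.g k).S} (h : Γ.emb j s = .inr ⟨k, t⟩) :
    j = k ∧ HEq s t ∧ s ∉ (Γ.g j).terminals := by
  by_cases hs : s ∈ (Γ.g j).terminals
  · simp [emb_of_mem _ hs] at h
  · rw [emb_of_notMem _ hs] at h
    obtain ⟨rfl, h'⟩ := Sigma.mk.inj (Sum.inr_injective h)
    exact ⟨rfl, h', hs⟩

/-- The graph obtained by gluing all gadgets onto the base graph. -/
def graph : SimpleGraph Γ.Vert where
  Adj x y := (∃ u v, X.Adj u v ∧ Sum.inl u = x ∧ Sum.inl v = y) ∨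
    ∃ j s t, (Γ.g j).G.Adj s t ∧ Γ.emb j s = x ∧ Γ.emb j t = y
  symm := ⟨by
    rintro x y (⟨u, v, h, hu, hv⟩ | ⟨j, s, t, h, hs, ht⟩)
    · exact Or.inl ⟨v, u, h.symm, hv, hu⟩
    · exact Or.inr ⟨j, t, s, h.symm, ht, hs⟩⟩
  loopless := ⟨by
    rintro x (⟨u, v, h, rfl, hv⟩ | ⟨j, s, t, h, rfl, ht⟩)
    · exact h.ne (Sum.inl_injective hv).symm
    · exact h.ne (Γ.emb_injective j ht).symm⟩

lemma adj_emb {j : J} {s t : (Γ.g j).S} (h : (Γ.g j).G.Adj s t) :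
    Γ.graph.Adj (Γ.emb j s) (Γ.emb j t) := Or.inr ⟨j, s, t, h, rfl, rfl⟩

lemma adj_inl_iff {u v : V} : Γ.graph.Adj (.inl u) (.inl v) ↔ X.Adj u v := by
  constructor
  · rintro (⟨u', v', h, hu, hv⟩ | ⟨j, s, t, h, hs, ht⟩)
    · rwa [← Sum.inl_injective hu, ← Sum.inl_injective hv]
    · by_cases hsT : s ∈ (Γ.g j).terminals <;> by_cases htT : t ∈ (Γ.g j).terminals
      · rw [emb_of_mem _ hsT] at hs
        rw [emb_of_mem _ htT] at ht
        rw [← Sum.inl_injective hs, ← Sum.inl_injective ht]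
        have he := Γ.adj_e j
        have hf := Γ.adj_f j
        rcases (Γ.g j).terminal_adj s t hsT htT h with h | h <;>
          rcases Sym2.eq_iff.1 h with ⟨rfl, rfl⟩ | ⟨rfl, rfl⟩
        exacts [he, he.symm, hf, hf.symm]
      · simp [emb_of_notMem _ htT] at ht
      · simp [emb_of_notMem _ hsT] at hs
      · simp [emb_of_notMem _ hsT] at hs
  · intro h
    exact Or.inl ⟨u, v, h, rfl, rfl⟩

lemma adj_inr {j : J} {s : (Γ.g j).S} {y : Γ.Vert} (h : Γ.graph.Adj (.inr ⟨j, s⟩) y) :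
    s ∉ (Γ.g j).terminals ∧ ∃ t, (Γ.g j).G.Adj s t ∧ Γ.emb j t = y := by
  rcases h with ⟨u, v, -, hu, -⟩ | ⟨k, s', t, hst, hs, ht⟩
  · simp at hu
  · obtain ⟨rfl, h, hsT⟩ := Γ.emb_eq_inr hs
    obtain rfl := eq_of_heq h
    exact ⟨hsT, t, hst, ht⟩

lemma sound {c : Sym2 Γ.Vert → Fin q} (hc : HFree H Γ.graph c) (j : J) :
    c s(.inl (Γ.ι j (Γ.g j).e₀), .inl (Γ.ι j (Γ.g j).e₁)) =
      c s(.inl (Γ.ι j (Γ.g j).f₀), .inl (Γ.ι j (Γ.g j).f₁)) ↔ (Γ.g j).sgn = true := by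
  have := (Γ.g j).sound _ (hc.comap (Γ.emb j) (Γ.emb_injective j) fun _ _ h => Γ.adj_emb h)
  simp only [Function.comp_apply, Sym2.map_mk] at this
  rwa [emb_of_mem, emb_of_mem, emb_of_mem, emb_of_mem] at this <;> simp [Gadget.terminals]

open Classical in
/-- Every copy of `H` that meets the interior of a gadget lies in that gadget. -/
lemma exists_lift_of_interior (hH : Robust H) {f : W ↪ Γ.Vert}
    (hf : ∀ a b, H.Adj a b → Γ.graph.Adj (f a) (f b)) {a₀ : W} {j : J} {s₀ : (Γ.g j).S}
    (h₀ : f a₀ = .inr ⟨j, s₀⟩) :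
    ∃ f' : W → (Γ.g j).S, (∀ a, f a = Γ.emb j (f' a)) ∧
      ∀ a b, H.Adj a b → (Γ.g j).G.Adj (f' a) (f' b) := by
  obtain ⟨l, hl1, hlh, hl⟩ := exists_missed_level f
    (Sum.elim (fun _ => 0) fun x => (Γ.g x.1).d x.2) 1
  have hint : ∀ a s, f a = .inr ⟨j, s⟩ → s ∉ (Γ.g j).terminals := fun a s h => by
    obtain ⟨b, hb, -⟩ := hH.exists_adj_ne a a
    exact (Γ.adj_inr (h ▸ hf a b hb)).1
  have hlev : ∀ a s, f a = .inr ⟨j, s⟩ → (Γ.g j).d s ≠ l := fun a s h => by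
    simpa [h] using hl a
  have key : ∀ (P : ℕ → Prop) (u v : (Γ.g j).S), u ∈ (Γ.g j).terminals →
      v ∈ (Γ.g j).terminals → (Γ.g j).G.Adj u v → P ((Γ.g j).d s₀) →
      (∀ s t, P ((Γ.g j).d s) → s ∉ (Γ.g j).terminals → (Γ.g j).G.Adj s t →
        (t ∈ (Γ.g j).terminals → t = u ∨ t = v) ∧
        (t ∉ (Γ.g j).terminals → (Γ.g j).d t ≠ l → P ((Γ.g j).d t))) →
      ∃ f' : W → (Γ.g j).S, (∀ a, f a = Γ.emb j (f' a)) ∧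
        ∀ a b, H.Adj a b → (Γ.g j).G.Adj (f' a) (f' b) := by
    intro P u v hu hv huv hs₀ hP
    have hall : ∀ b, (∃ s, f b = .inr ⟨j, s⟩ ∧ P ((Γ.g j).d s)) ∨ f b = .inl (Γ.ι j u) ∨
        f b = .inl (Γ.ι j v) := by
      refine hH.closed_image f _ _ (C := {b | ∃ s, f b = .inr ⟨j, s⟩ ∧ P ((Γ.g j).d s)})
        ⟨a₀, s₀, h₀, hs₀⟩ (by rintro a ⟨s, h, -⟩; simp [h]) ?_
      rintro a ⟨s, has, hs⟩ b hab
      obtain ⟨hsT, t, hst, ht⟩ := Γ.adj_inr (has ▸ hf a b hab)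
      obtain ⟨h1, h2⟩ := hP s t hs hsT hst
      by_cases htT : t ∈ (Γ.g j).terminals
      · rw [emb_of_mem _ htT] at ht
        rcases h1 htT with rfl | rfl
        · exact Or.inr (Or.inl ht.symm)
        · exact Or.inr (Or.inr ht.symm)
      · rw [emb_of_notMem _ htT] at ht
        exact Or.inl ⟨t, ht.symm, h2 htT (hlev b t ht.symm)⟩
    have hex : ∀ b, ∃ s, f b = Γ.emb j s ∧ (s ∈ (Γ.g j).terminals → s = u ∨ s = v) := by
      intro b
      rcases hall b with ⟨s, h, -⟩ | h | h
      · have := hint b s h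
        exact ⟨s, by rw [h, emb_of_notMem _ this], fun h => absurd h this⟩
      · exact ⟨u, by rw [h, emb_of_mem _ hu], fun _ => Or.inl rfl⟩
      · exact ⟨v, by rw [h, emb_of_mem _ hv], fun _ => Or.inr rfl⟩
    choose f' hf' hfT using hex
    have hinter : ∀ a b, H.Adj a b → f' a ∉ (Γ.g j).terminals →
        (Γ.g j).G.Adj (f' a) (f' b) := by
      intro a b hab ha
      have h := hf a b hab
      rw [hf' a, emb_of_notMem _ ha] at h
      obtain ⟨-, t, hst, ht⟩ := Γ.adj_inr h
      rw [hf' b] at ht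
      rwa [← Γ.emb_injective j ht]
    refine ⟨f', hf', fun a b hab => ?_⟩
    by_cases ha : f' a ∈ (Γ.g j).terminals
    · by_cases hb : f' b ∈ (Γ.g j).terminals
      · have hne : f' a ≠ f' b := fun h => hab.ne (f.injective (by rw [hf', hf', h]))
        rcases hfT a ha with h1 | h1 <;> rcases hfT b hb with h2 | h2 <;> rw [h1, h2] at hne ⊢
        · exact absurd rfl hne
        · exact huv
        · exact huv.symm
        · exact absurd rfl hne
      · exact (hinter b a hab.symm hb).symm
    · exact hinter a b hab ha
  rcases lt_or_gt_of_ne (hlev a₀ s₀ h₀) with h | h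
  · refine key (· < l) (Γ.g j).e₀ (Γ.g j).e₁ (by simp [Gadget.terminals])
      (by simp [Gadget.terminals]) (Γ.g j).adj_e h fun s t hs hsT hst => ⟨fun htT => ?_,
        fun htT hne => ?_⟩
    · exact ((Γ.g j).near s t hsT htT hst).1.resolve_right (by omega)
    · have := (Γ.g j).lip s t hsT htT hst
      omega
  · refine key (l < ·) (Γ.g j).f₀ (Γ.g j).f₁ (by simp [Gadget.terminals])
      (by simp [Gadget.terminals]) (Γ.g j).adj_f h fun s t hs hsT hst => ⟨fun htT => ?_,
        fun htT hne => ?_⟩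
    · exact ((Γ.g j).near s t hsT htT hst).2.resolve_right (by omega)
    · have := (Γ.g j).lip t s htT hsT hst.symm
      omega

/-- A colouring of the base graph that respects the gadgets extends to the glued graph; gadgets
attached to a deleted edge need not be respected. -/
lemma complete (hH : Robust H) [Nonempty V] (D : Set (Sym2 V)) {c : Sym2 V → Fin q}
    (hc : HFree H (X.deleteEdges D) c)
    (hg : ∀ j, s(Γ.ι j (Γ.g j).e₀, Γ.ι j (Γ.g j).e₁) ∉ D →
      s(Γ.ι j (Γ.g j).f₀, Γ.ι j (Γ.g j).f₁) ∉ D →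
      (c s(Γ.ι j (Γ.g j).e₀, Γ.ι j (Γ.g j).e₁) = c s(Γ.ι j (Γ.g j).f₀, Γ.ι j (Γ.g j).f₁) ↔
        (Γ.g j).sgn = true)) (hq : 2 ≤ q) :
    ∃ c' : Sym2 Γ.Vert → Fin q, HFree H (Γ.graph.deleteEdges (Sym2.map Sum.inl '' D)) c' ∧
      ∀ e, c' (e.map Sum.inl) = c e := by
  classical
  have hex : ∀ j, ∃ cj : Sym2 (Γ.g j).S → Fin q, HFree H (Γ.g j).G cj ∧
      (s(Γ.ι j (Γ.g j).e₀, Γ.ι j (Γ.g j).e₁) ∉ D →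
        cj s((Γ.g j).e₀, (Γ.g j).e₁) = c s(Γ.ι j (Γ.g j).e₀, Γ.ι j (Γ.g j).e₁)) ∧
      (s(Γ.ι j (Γ.g j).f₀, Γ.ι j (Γ.g j).f₁) ∉ D →
        cj s((Γ.g j).f₀, (Γ.g j).f₁) = c s(Γ.ι j (Γ.g j).f₀, Γ.ι j (Γ.g j).f₁)) := by
    intro j
    have hpart : ∀ x : Fin q, ∃ y : Fin q, (x = y ↔ (Γ.g j).sgn = true) := by
      intro x
      have : Nontrivial (Fin q) := Fin.nontrivial_iff_two_le.2 hq
      obtain ⟨y, hy⟩ := exists_ne x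
      cases (Γ.g j).sgn
      · exact ⟨y, by simpa using hy.symm⟩
      · exact ⟨x, by simp⟩
    by_cases he : s(Γ.ι j (Γ.g j).e₀, Γ.ι j (Γ.g j).e₁) ∈ D
    · obtain ⟨y, hy⟩ := hpart (c s(Γ.ι j (Γ.g j).f₀, Γ.ι j (Γ.g j).f₁))
      obtain ⟨cj, h1, -, h3⟩ := (Γ.g j).complete y _ (by rwa [eq_comm])
      exact ⟨cj, h1, fun h => absurd he h, fun _ => h3⟩
    · by_cases hf : s(Γ.ι j (Γ.g j).f₀, Γ.ι j (Γ.g j).f₁) ∈ D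
      · obtain ⟨y, hy⟩ := hpart (c s(Γ.ι j (Γ.g j).e₀, Γ.ι j (Γ.g j).e₁))
        obtain ⟨cj, h1, h2, -⟩ := (Γ.g j).complete _ y hy
        exact ⟨cj, h1, fun _ => h2, fun h => absurd hf h⟩
      · obtain ⟨cj, h1, h2, h3⟩ := (Γ.g j).complete _ _ (hg j he hf)
        exact ⟨cj, h1, fun _ => h2, fun _ => h3⟩
  choose cg hfree hce hcf using hex
  have hne : ∀ j, Nonempty (Γ.g j).S := fun j => ⟨(Γ.g j).e₀⟩
  let c' : Sym2 Γ.Vert → Fin q := fun e =>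
    if h : ∃ j s, Sum.inr ⟨j, s⟩ ∈ e then
      cg h.choose (e.map (Function.invFun (Γ.emb h.choose)))
    else c (e.map (Function.invFun Sum.inl))
  have hbase : ∀ e : Sym2 V, c' (e.map Sum.inl) = c e := by
    intro e
    have h : ¬ ∃ j s, (Sum.inr ⟨j, s⟩ : Γ.Vert) ∈ e.map Sum.inl := by
      rintro ⟨j, s, h⟩
      obtain ⟨u, -, hu⟩ := Sym2.mem_map.1 h
      simp at hu
    simp only [c', dif_neg h, Sym2.map_map]
    rw [Function.invFun_comp Sum.inl_injective, Sym2.map_id, id]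
  have hgad : ∀ j s t, s ∉ (Γ.g j).terminals →
      c' s(Γ.emb j s, Γ.emb j t) = cg j s(s, t) := by
    intro j s t hs
    have h : ∃ k r, (Sum.inr ⟨k, r⟩ : Γ.Vert) ∈ s(Γ.emb j s, Γ.emb j t) :=
      ⟨j, s, by simp [emb_of_notMem _ hs]⟩
    have hk : h.choose = j := by
      obtain ⟨r, hr⟩ := h.choose_spec
      rcases Sym2.mem_iff.1 hr with hr | hr
      · exact (Γ.emb_eq_inr hr.symm).1.symm
      · exact (Γ.emb_eq_inr hr.symm).1.symm
    have : ∀ k, k = j → cg k (Sym2.map (Function.invFun (Γ.emb k)) s(Γ.emb j s, Γ.emb j t)) =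
        cg j s(s, t) := by
      rintro k rfl
      rw [Sym2.map_mk, Function.leftInverse_invFun (Γ.emb_injective k),
        Function.leftInverse_invFun (Γ.emb_injective k)]
    simp only [c', dif_pos h]
    exact this _ hk
  refine ⟨c', ?_, hbase⟩
  rintro ⟨i, f, hf⟩
  have hadj : ∀ a b, H.Adj a b → Γ.graph.Adj (f a) (f b) := fun a b h =>
    (deleteEdges_adj.1 (hf a b h).1).1
  have hD : ∀ a b u v, H.Adj a b → f a = .inl u → f b = .inl v → s(u, v) ∉ D := by
    intro a b u v h hu hv hmem
    refine (deleteEdges_adj.1 (hf a b h).1).2 ⟨s(u, v), hmem, ?_⟩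
    rw [Sym2.map_mk, hu, hv]
  by_cases hint : ∃ a j s, f a = .inr ⟨j, s⟩
  · obtain ⟨a₀, j, s₀, h₀⟩ := hint
    obtain ⟨f', hf', hadj'⟩ := Γ.exists_lift_of_interior hH hadj h₀
    refine hfree j ⟨i, ⟨f', fun a b hab => f.injective (by rw [hf', hf', hab])⟩,
      fun a b hab => ⟨hadj' a b hab, ?_⟩⟩
    change cg j s(f' a, f' b) = i
    have hcol := (hf a b hab).2
    rw [hf' a, hf' b] at hcol
    by_cases ha : f' a ∈ (Γ.g j).terminals
    · by_cases hb : f' b ∈ (Γ.g j).terminals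
      · have hnD := hD a b _ _ hab ((hf' a).trans (emb_of_mem _ ha))
          ((hf' b).trans (emb_of_mem _ hb))
        rw [emb_of_mem _ ha, emb_of_mem _ hb, ← Sym2.map_mk, hbase] at hcol
        rw [← hcol]
        have hee : ∀ u v, s(f' a, f' b) = s(u, v) →
            s(Γ.ι j (f' a), Γ.ι j (f' b)) = s(Γ.ι j u, Γ.ι j v) := fun u v h => by
          rw [← Sym2.map_mk, h, Sym2.map_mk]
        rcases (Γ.g j).terminal_adj _ _ ha hb (hadj' a b hab) with h | h
        · rw [h, hee _ _ h]
          exact hce j (hee _ _ h ▸ hnD)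
        · rw [h, hee _ _ h]
          exact hcf j (hee _ _ h ▸ hnD)
      · rw [Sym2.eq_swap, hgad j _ _ hb] at hcol
        rw [Sym2.eq_swap, hcol]
    · rw [hgad j _ _ ha] at hcol
      exact hcol
  · have hex : ∀ a, ∃ u, f a = .inl u := by
      intro a
      rcases h : f a with u | ⟨j, s⟩
      · exact ⟨u, rfl⟩
      · exact absurd ⟨a, j, s, h⟩ hint
    choose f' hf' using hex
    refine hc ⟨i, ⟨f', fun a b hab => f.injective (by rw [hf', hf', hab])⟩,
      fun a b hab => ⟨deleteEdges_adj.2 ⟨?_, hD a b _ _ hab (hf' a) (hf' b)⟩, ?_⟩⟩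
    · have := hadj a b hab
      rwa [hf', hf', adj_inl_iff] at this
    · have := (hf a b hab).2
      rwa [hf', hf', ← Sym2.map_mk, hbase] at this

end Gluing

end

section

variable {W : Type} [Fintype W] {H : SimpleGraph W} {q : ℕ}

lemma exists_perm_pair {q : ℕ} {x y a b : Fin q} (hxy : x ≠ y) (hab : a ≠ b) :
    ∃ σ : Equiv.Perm (Fin q), σ x = a ∧ σ y = b := by
  refine ⟨Equiv.swap (Equiv.swap x a y) b * Equiv.swap x a, ?_, by simp⟩
  simp only [Equiv.Perm.coe_mul, Function.comp_apply, Equiv.swap_apply_left]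
  refine Equiv.swap_apply_of_ne_of_ne (fun h => ?_) hab
  have := (Equiv.swap x a).injective ((Equiv.swap_apply_left x a).trans h)
  exact hxy this

/-- A gadget forcing two edges with a common vertex to have different colours. -/
lemma exists_negative_apex_gadget (hH : Robust H) (hq : 2 ≤ q) :
    ∃ N : Gadget H q, N.sgn = false ∧ N.f₀ = N.e₀ ∧ N.e₀ ≠ N.e₁ ∧ N.e₀ ≠ N.f₁ ∧ N.e₁ ≠ N.f₁ := by
  obtain ⟨S, hS, G, w, y, p, d, hd, hdy, hdp, hwy, hwp, hG, hne⟩ := exists_apex_gadget hH hq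
  have hyp : y ≠ p := by rintro rfl; omega
  have hnadj : ¬ G.Adj y p := fun h => by
    have := hd y p h hwy.ne' hwp.ne'
    omega
  obtain ⟨c, hc⟩ := not_isRamsey_iff.1 hG
  refine ⟨⟨S, hS, G, w, y, w, p, d, false, hwy, hwp, ?_, ?_, ?_, ?_, ?_⟩, rfl, rfl, hwy.ne,
    hwp.ne, hyp⟩
  · intro s t hs ht hst
    simp only [Set.mem_insert_iff, Set.mem_singleton_iff, not_or] at hs ht
    exact hd s t hst hs.1 ht.1
  · intro s t hs ht hst
    simp only [Set.mem_insert_iff, Set.mem_singleton_iff, not_or] at hs ht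
    rcases ht with rfl | rfl | rfl | rfl
    · simp
    · have := hd t s hst.symm hwy.ne' hs.1
      exact ⟨by simp, Or.inr (by omega)⟩
    · simp
    · have := hd s t hst hs.1 hwp.ne'
      exact ⟨Or.inr (by omega), by simp⟩
  · intro s t hs ht hst
    simp only [Set.mem_insert_iff, Set.mem_singleton_iff] at hs ht
    have := hst.ne
    have := hst.symm
    rcases hs with rfl | rfl | rfl | rfl <;> rcases ht with rfl | rfl | rfl | rfl <;> simp_all
  · intro c hc
    simpa using hne c hc
  · intro x z hxz
    obtain ⟨σ, h1, h2⟩ := exists_perm_pair (hne c hc) (a := x) (b := z) (by simpa using hxz)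
    exact ⟨σ ∘ c, hc.comp_perm σ, h1, h2⟩

/-- The caterpillar in which the vertex `(k, 0)` is joined to all vertices `(k + 1, l)`. -/
def caterpillar (m q : ℕ) : SimpleGraph (Fin m × Fin q) where
  Adj u v := (v.1.val = u.1.val + 1 ∧ u.2.val = 0) ∨ (u.1.val = v.1.val + 1 ∧ v.2.val = 0)
  symm := ⟨fun u v h => h.symm⟩
  loopless := ⟨fun u h => by rcases h with h | h <;> omega⟩

lemma caterpillar_hFree (hH : Robust H) (m r : ℕ) (c : Sym2 (Fin m × Fin r) → Fin q) :
    HFree H (caterpillar m r) c := by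
  rintro ⟨i, f, hf⟩
  have := hH.nonempty
  obtain ⟨a, ha⟩ := Finite.exists_max fun a => (f a).1
  obtain ⟨b, hb, -⟩ := hH.exists_adj_ne a a
  obtain ⟨b', hb', hne⟩ := hH.exists_adj_ne a b
  have key : ∀ b, H.Adj a b → (f a).1.val = (f b).1.val + 1 ∧ (f b).2.val = 0 := by
    intro b hb
    rcases (hf a b hb).1 with h | h
    · have : (f b).1.val ≤ (f a).1.val := ha b
      omega
    · exact h
  have h1 := key b hb
  have h2 := key b' hb'
  exact hne (f.injective (Prod.ext (Fin.ext (by omega)) (Fin.ext (by omega))))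

/-- The colouring of the caterpillar in which an edge takes the value of its higher endpoint. -/
def childColour {m r q : ℕ} (x₀ : Fin q) (χ : Fin m × Fin r → Fin q) :
    Sym2 (Fin m × Fin r) → Fin q :=
  Sym2.lift ⟨fun u v => if u.1 < v.1 then χ v else if v.1 < u.1 then χ u else x₀, by
    intro u v
    rcases lt_trichotomy u.1 v.1 with h | h | h
    · simp [h, h.not_gt]
    · simp [h]
    · simp [h, h.not_gt]⟩

lemma childColour_mk {m r q : ℕ} {x₀ : Fin q} {χ : Fin m × Fin r → Fin q} {u v : Fin m × Fin r}
    (h : u.1 < v.1) : childColour x₀ χ s(u, v) = χ v := by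
  simp [childColour, h]

section caterpillar

variable {m : ℕ} (z : Fin q) (kind : Fin m → Prop)

/-- The edges at `(k + 1, 0)` in the caterpillar are indexed by `Option (Fin q)`; this is the
other endpoint. -/
def spoke (k : Fin m) (o : Option (Fin q)) : Fin (m + 2) × Fin q :=
  o.elim (⟨k, by omega⟩, z) fun l => (⟨k + 2, by omega⟩, l)

/-- The middle vertex `(k + 1, 0)` of a link of the caterpillar. -/
def hubVertex (k : Fin m) : Fin (m + 2) × Fin q := (⟨k + 1, by omega⟩, z)

/-- The pairs of edges at `(k + 1, 0)` that have to receive different colours in order that the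
edges leading to `(k, 0)` and `(k + 2, 0)` have equal colours if `kind k` holds and different
colours otherwise. -/
abbrev LinkPair : Type := {x : Fin m × Option (Fin q) × Option (Fin q) //
  x.2.1 ≠ x.2.2 ∧ ((x.2.1 = none ∧ x.2.2 = some z ∨ x.2.1 = some z ∧ x.2.2 = none) ↔ ¬ kind x.1)}

variable {z kind}

lemma hubVertex_adj_spoke (hz : z.val = 0) (k : Fin m) (o : Option (Fin q)) :
    (caterpillar (m + 2) q).Adj (hubVertex z k) (spoke z k o) := by
  cases o <;> simp [caterpillar, hubVertex, spoke, hz]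

lemma hubVertex_ne_spoke (k : Fin m) (o : Option (Fin q)) : hubVertex z k ≠ spoke z k o := by
  cases o <;> simp [hubVertex, spoke]

lemma spoke_injective (k : Fin m) : Function.Injective (spoke z k) := by
  rintro (_ | l) (_ | l') h
  · rfl
  · simp [spoke] at h
  · simp [spoke] at h
  · simpa [spoke] using h

open Classical in
/-- Copies of a negative apex gadget placed on the caterpillar. -/
noncomputable abbrev linkGluing (hz : z.val = 0) (kind : Fin m → Prop) (N : Gadget H q)
    (h₀ : N.f₀ = N.e₀) (h₁ : N.e₀ ≠ N.e₁) (h₂ : N.e₀ ≠ N.f₁) (h₃ : N.e₁ ≠ N.f₁) :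
    Gluing (caterpillar (m + 2) q) H q (LinkPair z kind) where
  g _ := N
  ι j s := if s = N.e₀ then hubVertex z j.1.1 else if s = N.e₁ then spoke z j.1.1 j.1.2.1 else
    spoke z j.1.1 j.1.2.2
  injOn j := by
    have hA := hubVertex_ne_spoke (z := z) j.1.1 j.1.2.1
    have hB := hubVertex_ne_spoke (z := z) j.1.1 j.1.2.2
    have hC : spoke z j.1.1 j.1.2.1 ≠ spoke z j.1.1 j.1.2.2 :=
      fun h => j.2.1 (spoke_injective _ h)
    have hT : N.terminals = {N.e₀, N.e₁, N.f₁} := by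
      ext x; simp [Gadget.terminals, h₀]; tauto
    rw [hT]
    rintro s (rfl | rfl | rfl) t (rfl | rfl | rfl) h <;>
      simp [h₁.symm, h₂.symm, h₃.symm, hA, hB, hC, hA.symm, hB.symm, hC.symm] at h ⊢
  adj_e j := by simpa [h₁.symm] using hubVertex_adj_spoke hz _ _
  adj_f j := by simpa [h₀, h₂.symm, h₃.symm] using hubVertex_adj_spoke hz _ _

variable (hz : z.val = 0) (N : Gadget H q)
    (h₀ : N.f₀ = N.e₀) (h₁ : N.e₀ ≠ N.e₁) (h₂ : N.e₀ ≠ N.f₁) (h₃ : N.e₁ ≠ N.f₁)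

/-- The distance to the lower end in the glued caterpillar. -/
def linkLevel : (linkGluing hz kind N h₀ h₁ h₂ h₃).Vert → ℕ :=
  Sum.elim (fun u => u.1.val - 1) fun x => x.1.1.1.val

lemma linkLevel_le {x y : (linkGluing hz kind N h₀ h₁ h₂ h₃).Vert}
    (h : (linkGluing hz kind N h₀ h₁ h₂ h₃).graph.Adj x y) :
    linkLevel hz N h₀ h₁ h₂ h₃ y ≤ linkLevel hz N h₀ h₁ h₂ h₃ x + 1 := by
  classical
  rcases h with ⟨u, v, huv, rfl, rfl⟩ | ⟨j, s, t, hst, rfl, rfl⟩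
  · simp only [linkLevel, Sum.elim_inl]
    rcases huv with h | h <;> omega
  · change N.S at s t
    replace hst : N.G.Adj s t := hst
    have key : ∀ s : N.S,
        (j.1.1.val ≤ linkLevel hz N h₀ h₁ h₂ h₃ (Gluing.emb _ j s) + 1 ∧
          linkLevel hz N h₀ h₁ h₂ h₃ (Gluing.emb _ j s) ≤ j.1.1.val + 1) ∧
        (s ≠ N.e₁ → s ≠ N.f₁ → linkLevel hz N h₀ h₁ h₂ h₃ (Gluing.emb _ j s) = j.1.1.val) := by
      intro s
      have hsp : ∀ o, j.1.1.val ≤ (spoke z j.1.1 o).1.val - 1 + 1 ∧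
          (spoke z j.1.1 o).1.val - 1 ≤ j.1.1.val + 1 := by
        rintro (_ | l) <;> simp [spoke] <;> omega
      by_cases hs : s ∈ N.terminals
      · rw [Gluing.emb_of_mem _ hs]
        have : s = N.e₀ ∨ s = N.e₁ ∨ s = N.f₁ := by
          simp only [Gadget.terminals, h₀, Set.mem_insert_iff, Set.mem_singleton_iff] at hs
          tauto
        rcases this with rfl | rfl | rfl
        · simp [linkLevel, linkGluing, hubVertex]
        · simpa [linkLevel, linkGluing, h₁.symm] using hsp _
        · simpa [linkLevel, linkGluing, h₂.symm, h₃.symm] using hsp _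
      · rw [Gluing.emb_of_notMem _ hs]
        simp [linkLevel]
    have hs := key s
    have ht := key t
    by_cases h : (s ≠ N.e₁ ∧ s ≠ N.f₁) ∨ (t ≠ N.e₁ ∧ t ≠ N.f₁)
    · rcases h with h | h
      · have := hs.2 h.1 h.2
        omega
      · have := ht.2 h.1 h.2
        omega
    · exfalso
      have hadj : N.G.Adj N.e₁ N.f₁ := by
        have hne := hst.ne
        have hst' := hst.symm
        have hs' : s = N.e₁ ∨ s = N.f₁ := by tauto
        have ht' : t = N.e₁ ∨ t = N.f₁ := by tauto
        rcases hs' with rfl | rfl <;> rcases ht' with rfl | rfl <;> tauto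
      have := N.terminal_adj _ _ (by simp) (by simp) hadj
      rw [h₀] at this
      rcases this with h | h <;> rcases Sym2.eq_iff.1 h with h | h
      · exact h₁ h.1.symm
      · exact h₂ h.2.symm
      · exact h₁ h.1.symm
      · exact h₂ h.2.symm

end caterpillar

end

section

variable {W : Type} [Fintype W] {H : SimpleGraph W} {q : ℕ}

section caterpillar

variable {m : ℕ} {z : Fin q} {kind : Fin m → Prop} (hz : z.val = 0) (N : Gadget H q)
    (h₀ : N.f₀ = N.e₀) (h₁ : N.e₀ ≠ N.e₁) (h₂ : N.e₀ ≠ N.f₁) (h₃ : N.e₁ ≠ N.f₁)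

lemma linkGluing_sound (hN : N.sgn = false)
    {c : Sym2 (linkGluing hz kind N h₀ h₁ h₂ h₃).Vert → Fin q}
    (hc : HFree H (linkGluing hz kind N h₀ h₁ h₂ h₃).graph c) (k : Fin m) :
    c s(.inl (k.castSucc.castSucc, z), .inl (k.castSucc.succ, z)) =
      c s(.inl (k.succ.castSucc, z), .inl (k.succ.succ, z)) ↔ kind k := by
  have hlink : ∀ o o', o ≠ o' → ((o = none ∧ o' = some z ∨ o = some z ∧ o' = none) ↔ ¬ kind k) →
      c s(.inl (hubVertex z k), .inl (spoke z k o)) ≠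
        c s(.inl (hubVertex z k), .inl (spoke z k o')) := by
    intro o o' h h'
    have := (linkGluing hz kind N h₀ h₁ h₂ h₃).sound hc ⟨(k, o, o'), h, h'⟩
    simpa [hN, h₀, h₁.symm, h₂.symm, h₃.symm] using this
  have hnone : c s(.inl (k.castSucc.castSucc, z), .inl (k.castSucc.succ, z)) =
      c s(.inl (hubVertex z k), .inl (spoke z k none)) := by
    rw [Sym2.eq_swap]; rfl
  have hsome : c s(.inl (k.succ.castSucc, z), .inl (k.succ.succ, z)) =
      c s(.inl (hubVertex z k), .inl (spoke z k (some z))) := rfl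
  rw [hnone, hsome]
  constructor
  · intro h
    by_contra hk
    exact hlink none (some z) (by simp) (by simp [hk]) h
  · intro hk
    obtain ⟨o, o', hne, heq⟩ := Fintype.exists_ne_map_eq_of_card_lt
      (fun o => c s(.inl (hubVertex z k), .inl (spoke z k o))) (by simp)
    by_cases h : o = none ∧ o' = some z ∨ o = some z ∧ o' = none
    · rcases h with ⟨rfl, rfl⟩ | ⟨rfl, rfl⟩
      exacts [heq, heq.symm]
    · exact absurd heq (hlink o o' hne (by simp [h, hk]))

lemma linkGluing_complete (hH : Robust H) (hq : 2 ≤ q) (hN : N.sgn = false)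
    (X : Fin (m + 1) → Fin q)
    (hX : ∀ k : Fin m, X k.castSucc = X k.succ ↔ kind k) :
    ∃ c : Sym2 (linkGluing hz kind N h₀ h₁ h₂ h₃).Vert → Fin q,
      HFree H (linkGluing hz kind N h₀ h₁ h₂ h₃).graph c ∧
      ∀ k : Fin (m + 1), c s(.inl (k.castSucc, z), .inl (k.succ, z)) = X k := by
  let χ : Fin (m + 2) × Fin q → Fin q := fun u =>
    Fin.cases z (fun k => Equiv.swap z (X k) u.2) u.1
  have hnone : ∀ k : Fin m, childColour z χ s(hubVertex z k, spoke z k none) = X k.castSucc := by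
    intro k
    rw [Sym2.eq_swap, childColour_mk (by simp [hubVertex, spoke])]
    change Equiv.swap z (X k.castSucc) z = _
    simp
  have hsome : ∀ (k : Fin m) l, childColour z χ s(hubVertex z k, spoke z k (some l)) =
      Equiv.swap z (X k.succ) l := by
    intro k l
    rw [childColour_mk (by simp [hubVertex, spoke])]
    rfl
  have hne : ∀ k l, ((l = z) ↔ ¬ kind k) → X k.castSucc ≠ Equiv.swap z (X k.succ) l := by
    intro k l h
    by_cases hk : kind k
    · rw [(hX k).2 hk]
      intro h'
      exact h.not.2 (not_not.2 hk) ((Equiv.swap z (X k.succ)).injective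
        (h'.symm.trans (Equiv.swap_apply_left _ _).symm))
    · rw [h.2 hk, Equiv.swap_apply_left]
      exact (hX k).not.2 hk
  have : Nonempty (Fin (m + 2) × Fin q) := ⟨(0, z)⟩
  have hpair : ∀ j : LinkPair z kind, childColour z χ s(hubVertex z j.1.1, spoke z j.1.1 j.1.2.1) ≠
      childColour z χ s(hubVertex z j.1.1, spoke z j.1.1 j.1.2.2) := by
    rintro ⟨⟨k, _ | l, _ | l'⟩, h, h'⟩
    · exact absurd rfl h
    · rw [hnone, hsome]
      exact hne k l' (by simpa using h')
    · rw [hnone, hsome]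
      exact (hne k l (by simpa using h')).symm
    · rw [hsome, hsome]
      exact fun h'' => h (congrArg some ((Equiv.swap z (X k.succ)).injective h''))
  obtain ⟨c, hc, hbase⟩ := (linkGluing hz kind N h₀ h₁ h₂ h₃).complete (c := childColour z χ) hH ∅
    (by rw [deleteEdges_empty]; exact caterpillar_hFree hH _ _ _)
    (fun j _ _ => by simpa [hN, h₀, h₁.symm, h₂.symm, h₃.symm] using hpair j) hq
  refine ⟨c, by simpa using hc, fun k => ?_⟩
  rw [← Sym2.map_mk, hbase, childColour_mk (by simp [Fin.lt_def])]
  change Equiv.swap z (X k) z = _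
  simp

end caterpillar

/-- Gadgets forcing two disjoint edges to have equal colours or different colours. -/
lemma exists_far_gadget (hH : Robust H) (hq : 2 ≤ q) (b : Bool) :
    ∃ g : Gadget H q, g.sgn = b ∧ g.e₀ ≠ g.f₀ ∧ g.e₀ ≠ g.f₁ ∧ g.e₁ ≠ g.f₀ ∧ g.e₁ ≠ g.f₁ := by
  obtain ⟨N, hN, h₀, h₁, h₂, h₃⟩ := exists_negative_apex_gadget hH hq
  obtain ⟨m, hm⟩ : ∃ m, m = Fintype.card W + 4 := ⟨_, rfl⟩
  let z : Fin q := ⟨0, by omega⟩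
  have hz : z.val = 0 := rfl
  let kind : Fin (m + 1) → Prop := fun k => b = true ∨ k ≠ 0
  have : Finite N.S := N.finite
  have hlev := fun x y => linkLevel_le (kind := kind) hz N h₀ h₁ h₂ h₃ (x := x) (y := y)
  have hsound := fun c => linkGluing_sound (kind := kind) hz N h₀ h₁ h₂ h₃ hN (c := c)
  have hcomplete := linkGluing_complete (kind := kind) hz N h₀ h₁ h₂ h₃ hH hq hN
  set Γ := linkGluing hz kind N h₀ h₁ h₂ h₃ with hΓ
  let d := linkLevel (kind := kind) hz N h₀ h₁ h₂ h₃
  have hd0 : d (.inl (0, z)) = 0 := rfl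
  have hd1 : d (.inl (1, z)) = 0 := by simp [d, linkLevel]
  have hd2 : d (.inl ((Fin.last (m + 1)).castSucc, z)) = m := by simp [d, linkLevel]
  have hd3 : d (.inl (Fin.last (m + 2), z)) = m + 1 := by simp [d, linkLevel]
  refine ⟨⟨Γ.Vert, inferInstance, Γ.graph, .inl (0, z), .inl (1, z),
    .inl ((Fin.last (m + 1)).castSucc, z), .inl (Fin.last (m + 2), z), d, b, ?_, ?_, ?_, ?_, ?_, ?_,
    ?_⟩, rfl, ?_, ?_, ?_, ?_⟩
  · exact Γ.adj_inl_iff.2 (Or.inl (by simp [z]))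
  · exact Γ.adj_inl_iff.2 (Or.inl (by simp [z]))
  · exact fun s t _ _ h => hlev s t h
  · intro s t _ ht h
    have h1 : d t ≤ d s + 1 := hlev s t h
    have h2 : d s ≤ d t + 1 := hlev t s h.symm
    rcases ht with rfl | rfl | rfl | rfl
    · exact ⟨by simp, Or.inr (by omega)⟩
    · exact ⟨by simp, Or.inr (by omega)⟩
    · exact ⟨Or.inr (by omega), by simp⟩
    · exact ⟨Or.inr (by omega), by simp⟩
  · intro s t hs ht h
    have h1 : d t ≤ d s + 1 := hlev s t h
    have h2 : d s ≤ d t + 1 := hlev t s h.symm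
    have hne := h.ne
    rcases hs with rfl | rfl | rfl | rfl <;> rcases ht with rfl | rfl | rfl | rfl <;>
      first | exact absurd rfl hne | exact Or.inl rfl | exact Or.inr rfl |
        exact Or.inl Sym2.eq_swap | exact Or.inr Sym2.eq_swap | omega
  · intro c hc
    let μ : Fin (m + 2) → Fin q := fun k => c s(.inl (k.castSucc, z), .inl (k.succ, z))
    have hμ : ∀ k : Fin (m + 1), μ k.castSucc = μ k.succ ↔ kind k := hsound c hc
    have hind : ∀ k : Fin (m + 1), μ k.succ = μ (Fin.succ 0) := by
      intro k
      induction k using Fin.induction with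
      | zero => rfl
      | succ k ih =>
        rw [← ih, ← (hμ k.succ).2 (Or.inr (by simp))]
        rfl
    have hlast := hind (Fin.last m)
    have h01 := hμ 0
    change μ 0 = μ (Fin.last m).succ ↔ _
    rw [hlast]
    refine h01.trans ?_
    simp [kind]
  · intro x y hxy
    obtain ⟨c, hc, hX⟩ := hcomplete (Fin.cons x fun _ => y) (by
      intro k
      refine Fin.cases ?_ (fun k => ?_) k
      · simpa [kind] using hxy
      · simp [kind])
    exact ⟨c, hc, hX 0, by simpa [← Fin.succ_last] using hX (Fin.last (m + 1))⟩
  all_goals simp [Fin.ext_iff, hm]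

end

section

variable {W : Type} [Fintype W] {H : SimpleGraph W} {q : ℕ}

lemma Robust.const (hH : Robust H) {α : Type} {κ : W → α} (h : ∀ a b, H.Adj a b → κ a = κ b)
    (a b : W) : κ a = κ b := by
  by_contra hab
  obtain ⟨d, hd, hdb⟩ := hH.exists_adj_ne b b
  rcases hH.closed b b {x | κ x = κ a} ⟨a, rfl⟩ (fun h' => hab h'.symm) (fun h' => hab h'.symm)
    (fun x hx y hxy => Or.inl ((h x y hxy).symm.trans hx)) d with h' | h' | h'
  · exact hab (h'.symm.trans (h b d hd).symm)
  · exact hdb h'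
  · exact hdb h'

/-- The edges of `H` have a 3-colouring using all colours. -/
lemma Robust.exists_edge_classes (hH : Robust H) :
    ∃ g : Sym2 W → Fin 3, ∀ i, ∃ e ∈ H.edgeSet, g e = i := by
  classical
  obtain ⟨a⟩ := hH.nonempty
  obtain ⟨b, hab, hba⟩ := hH.exists_adj_ne a a
  obtain ⟨d, had, hdb⟩ := hH.exists_adj_ne a b
  obtain ⟨x, hbx, hxa⟩ := hH.exists_adj_ne b a
  refine ⟨fun e => if e = s(a, b) then 0 else if e = s(a, d) then 1 else 2, fun i => ?_⟩
  fin_cases i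
  · exact ⟨s(a, b), hab, by simp⟩
  · exact ⟨s(a, d), had, by simp [hdb, hba.symm]⟩
  · refine ⟨s(b, x), hbx, ?_⟩
    have h1 : s(b, x) ≠ s(a, b) := by simp [hxa, hba]
    have h2 : s(b, x) ≠ s(a, d) := by simp [hba, hxa, hdb.symm]
    simp [h1, h2]

/-- Constraints that some pairs of disjoint edges of a graph receive equal or different colours
can be realised by a larger graph. -/
lemma exists_constrained_extension (hH : Robust H) (hq : 2 ≤ q) {V : Type} [Finite V] [Nonempty V]
    (X : SimpleGraph V) (R : Sym2 V → Sym2 V → Bool → Prop)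
    (hR : ∀ e f b, R e f b → e ∈ X.edgeSet ∧ f ∈ X.edgeSet ∧ ∀ v ∈ e, v ∉ f) :
    ∃ (Y : Type) (_ : Finite Y) (G : SimpleGraph Y) (ι : X ↪g G),
      (∀ c : Sym2 Y → Fin q, HFree H G c → ∀ e f b, R e f b →
        (c (e.map ι) = c (f.map ι) ↔ b = true)) ∧
      ∀ (D : Set (Sym2 V)) (c : Sym2 V → Fin q), HFree H (X.deleteEdges D) c →
        (∀ e f b, R e f b → e ∉ D → f ∉ D → (c e = c f ↔ b = true)) →
        ∃ c' : Sym2 Y → Fin q, HFree H (G.deleteEdges (Sym2.map ι '' D)) c' := by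
  classical
  choose g hsgn h1 h2 h3 h4 using exists_far_gadget hH hq
  have hrep : ∀ e : Sym2 V, ∃ p : V × V, s(p.1, p.2) = e :=
    fun e => e.ind fun x y => ⟨(x, y), rfl⟩
  choose p hp using hrep
  have hfin : ∀ b, Finite (g b).S := fun b => (g b).finite
  let J : Type := {x : Sym2 V × Sym2 V × Bool // R x.1 x.2.1 x.2.2}
  have hJ : ∀ j : J, s((p j.1.1).1, (p j.1.1).2) ∈ X.edgeSet ∧
      s((p j.1.2.1).1, (p j.1.2.1).2) ∈ X.edgeSet ∧
      ∀ v ∈ s((p j.1.1).1, (p j.1.1).2), v ∉ s((p j.1.2.1).1, (p j.1.2.1).2) := by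
    intro j
    rw [hp, hp]
    exact hR _ _ _ j.2
  let ι : ∀ j : J, (g j.1.2.2).S → V := fun j s =>
    if s = (g j.1.2.2).e₀ then (p j.1.1).1 else if s = (g j.1.2.2).e₁ then (p j.1.1).2 else
    if s = (g j.1.2.2).f₀ then (p j.1.2.1).1 else (p j.1.2.1).2
  have hι0 : ∀ j, ι j (g j.1.2.2).e₀ = (p j.1.1).1 := fun j => by simp [ι]
  have hι1 : ∀ j, ι j (g j.1.2.2).e₁ = (p j.1.1).2 := fun j => by
    simp [ι, (g j.1.2.2).adj_e.ne']
  have hι2 : ∀ j, ι j (g j.1.2.2).f₀ = (p j.1.2.1).1 := fun j => by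
    simp [ι, (h1 _).symm, (h3 _).symm]
  have hι3 : ∀ j, ι j (g j.1.2.2).f₁ = (p j.1.2.1).2 := fun j => by
    simp [ι, (h2 _).symm, (h4 _).symm, (g j.1.2.2).adj_f.ne']
  let Γ : Gluing X H q J :=
    { g := fun j => g j.1.2.2
      ι := ι
      injOn := by
        intro j s hs t ht h
        obtain ⟨ha, hb, hc⟩ := hJ j
        have ha' := ha.ne
        have hb' := hb.ne
        simp only [Sym2.mem_iff, not_or, forall_eq_or_imp, forall_eq] at hc
        obtain ⟨⟨hc1, hc2⟩, hc3, hc4⟩ := hc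
        rcases hs with rfl | rfl | rfl | rfl <;> rcases ht with rfl | rfl | rfl | rfl <;>
          simp only [hι0, hι1, hι2, hι3] at h <;> first | rfl | exact absurd h ‹_› |
            exact absurd h.symm ‹_›
      adj_e := fun j => by rw [hι0, hι1]; exact (hJ j).1
      adj_f := fun j => by rw [hι2, hι3]; exact (hJ j).2.1 }
  have hΓe : ∀ j, s(Γ.ι j (Γ.g j).e₀, Γ.ι j (Γ.g j).e₁) = j.1.1 := fun j => by
    change s(ι j (g _).e₀, ι j (g _).e₁) = _
    rw [hι0, hι1, hp]
  have hΓf : ∀ j, s(Γ.ι j (Γ.g j).f₀, Γ.ι j (Γ.g j).f₁) = j.1.2.1 := fun j => by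
    change s(ι j (g _).f₀, ι j (g _).f₁) = _
    rw [hι2, hι3, hp]
  have hΓs : ∀ j, (Γ.g j).sgn = j.1.2.2 := fun j => hsgn _
  refine ⟨Γ.Vert, ?_, Γ.graph, ⟨⟨Sum.inl, Sum.inl_injective⟩, Γ.adj_inl_iff⟩, ?_, ?_⟩
  · have : ∀ j, Finite (Γ.g j).S := fun j => hfin _
    infer_instance
  · intro c hc e f b hefb
    have := Γ.sound hc ⟨(e, f, b), hefb⟩
    rw [← Sym2.map_mk (f := Sum.inl), hΓe, ← Sym2.map_mk (f := Sum.inl), hΓf, hΓs] at this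
    exact this
  · intro D c hc hcon
    obtain ⟨c', hc', -⟩ := Γ.complete hH D hc (fun j => by
      rw [hΓe, hΓf, hΓs]
      exact hcon _ _ _ j.2) hq
    exact ⟨c', hc'⟩

end

section

variable {W : Type} {H : SimpleGraph W} {q : ℕ}

/-- A homomorphism from a finite graph to itself that is injective on vertices is surjective on
edges. -/
lemma exists_edge_preimage [Finite W] {f : W → W} (hf : Function.Injective f)
    (hadj : ∀ a b, H.Adj a b → H.Adj (f a) (f b)) {e : Sym2 W} (he : e ∈ H.edgeSet) :
    ∃ e' ∈ H.edgeSet, e'.map f = e := by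
  have hmaps : ∀ e ∈ H.edgeSet, e.map f ∈ H.edgeSet := fun e => e.ind fun a b h => hadj a b h
  have hinj : Function.Injective fun e : H.edgeSet =>
      (⟨e.1.map f, hmaps _ e.2⟩ : H.edgeSet) := fun e e' h =>
    Subtype.ext (Sym2.map.injective hf (Subtype.ext_iff.1 h))
  obtain ⟨e', he'⟩ := Finite.surjective_of_injective hinj ⟨e, he⟩
  exact ⟨e'.1, e'.2, Subtype.ext_iff.1 he'⟩

variable {V R K : Type} (P : SimpleGraph V)

variable (H R K) in
/-- The disjoint union of `P`, single edges indexed by `R` and copies of `H` indexed by `K`. -/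
def cspBase : SimpleGraph (V ⊕ R × Bool ⊕ K × W) where
  Adj
    | .inl u, .inl v => P.Adj u v
    | .inr (.inl (r, b)), .inr (.inl (r', b')) => r = r' ∧ b ≠ b'
    | .inr (.inr (k, a)), .inr (.inr (k', a')) => k = k' ∧ H.Adj a a'
    | _, _ => False
  symm := ⟨by
    rintro (u | ⟨r, b⟩ | ⟨k, a⟩) (u' | ⟨r', b'⟩ | ⟨k', a'⟩) h <;> try exact h.elim
    · exact P.adj_symm h
    · exact ⟨h.1.symm, h.2.symm⟩
    · exact ⟨h.1.symm, h.2.symm⟩⟩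
  loopless := ⟨by
    rintro (u | ⟨r, b⟩ | ⟨k, a⟩) h
    · exact P.loopless.irrefl _ h
    · exact h.2 rfl
    · exact H.loopless.irrefl _ h.2⟩

/-- The edge of `cspBase` corresponding to `r`. -/
def varEdge (r : R) : Sym2 (V ⊕ R × Bool ⊕ K × W) :=
  s(.inr (.inl (r, false)), .inr (.inl (r, true)))

/-- The edges of the copy `k` of `H` in `cspBase`. -/
def copyEdge (k : K) (e : Sym2 W) : Sym2 (V ⊕ R × Bool ⊕ K × W) :=
  e.map fun a => .inr (.inr (k, a))

/-- The component of a vertex of `cspBase`. -/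
def cspComponent : V ⊕ R × Bool ⊕ K × W → Unit ⊕ R ⊕ K
  | .inl _ => .inl ()
  | .inr (.inl (r, _)) => .inr (.inl r)
  | .inr (.inr (k, _)) => .inr (.inr k)

open Classical in
/-- A colouring of `cspBase`. -/
noncomputable def cspColour (x₀ : Fin q) (c : Sym2 V → Fin q) (a : R → Fin q)
    (κ : K → Sym2 W → Fin q) : Sym2 (V ⊕ R × Bool ⊕ K × W) → Fin q :=
  Sym2.lift ⟨fun
    | .inl u, .inl v => c s(u, v)
    | .inr (.inl (r, _)), .inr (.inl (r', _)) => if r = r' then a r else x₀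
    | .inr (.inr (k, b)), .inr (.inr (k', b')) => if k = k' then κ k s(b, b') else x₀
    | _, _ => x₀, by
    rintro (u | ⟨r, b⟩ | ⟨k, a⟩) (u' | ⟨r', b'⟩ | ⟨k', a'⟩) <;> try rfl
    · simp only [Sym2.eq_swap]
    · by_cases h : r = r'
      · subst h; simp
      · simp [h, Ne.symm h]
    · by_cases h : k = k'
      · subst h; simp [Sym2.eq_swap]
      · simp [h, Ne.symm h]⟩

section cspColour

variable {P} (x₀ : Fin q) (c : Sym2 V → Fin q) (a : R → Fin q) (κ : K → Sym2 W → Fin q)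

lemma cspColour_inl (e : Sym2 V) : cspColour x₀ c a κ (e.map Sum.inl) = c e :=
  e.ind fun _ _ => rfl

lemma cspColour_varEdge (r : R) : cspColour x₀ c a κ (varEdge r) = a r := by
  simp [cspColour, varEdge]

lemma cspColour_copyEdge (k : K) (e : Sym2 W) : cspColour x₀ c a κ (copyEdge k e) = κ k e :=
  e.ind fun _ _ => by simp [cspColour, copyEdge]

lemma cspColour_hFree [Fintype W] (hH : Robust H) {D : Set (Sym2 V)}
    (hc : HFree H (P.deleteEdges D) c)
    (hκ : ∀ k i, ∃ e ∈ H.edgeSet, κ k e ≠ i) :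
    HFree H ((cspBase H R K P).deleteEdges (Sym2.map Sum.inl '' D)) (cspColour x₀ c a κ) := by
  classical
  rintro ⟨i, f, hf⟩
  have hadj : ∀ x y, H.Adj x y → (cspBase H R K P).Adj (f x) (f y) := fun x y h =>
    (deleteEdges_adj.1 (hf x y h).1).1
  have hcomp := hH.const (κ := fun x => cspComponent (f x)) (by
    intro x y h
    have := hadj x y h
    rcases hx : f x with u | ⟨r, b⟩ | ⟨k, a⟩ <;> rcases hy : f y with u' | ⟨r', b'⟩ | ⟨k', a'⟩ <;>
      rw [hx, hy] at this <;> first | exact this.elim | rfl | skip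
    · simp [cspComponent, this.1]
    · simp [cspComponent, this.1])
  obtain ⟨x₁⟩ := hH.nonempty
  rcases hx₁ : f x₁ with u | ⟨r, b⟩ | ⟨k, a₁⟩
  · have hex : ∀ x, ∃ v, f x = .inl v := by
      intro x
      have := hcomp x x₁
      simp only [hx₁] at this
      rcases hx : f x with u | ⟨r, b⟩ | ⟨k, a⟩ <;> simp [hx, cspComponent] at this ⊢
    choose f' hf' using hex
    refine hc ⟨i, ⟨f', fun x y h => f.injective (by rw [hf', hf', h])⟩, fun x y h => ?_⟩
    obtain ⟨h1, h2⟩ := hf x y h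
    rw [deleteEdges_adj] at h1 ⊢
    rw [hf', hf', ← Sym2.map_mk] at h1 h2
    rw [cspColour_inl] at h2
    exact ⟨⟨h1.1, fun h' => h1.2 ⟨_, h', rfl⟩⟩, h2⟩
  · have hsub : ∀ x, f x ∈ ({.inr (.inl (r, false)), .inr (.inl (r, true))} :
        Finset (V ⊕ R × Bool ⊕ K × W)) := by
      intro x
      have := hcomp x x₁
      simp only [hx₁] at this
      rcases hx : f x with u | ⟨r, _ | _⟩ | ⟨k, a⟩ <;> simp_all [cspComponent]
    have h1 := Finset.card_le_card_of_injOn (s := Finset.univ) f (fun x _ => hsub x)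
      f.injective.injOn
    have h2 := Finset.card_le_two (a := (.inr (.inl (r, false)) : V ⊕ R × Bool ⊕ K × W))
      (b := .inr (.inl (r, true)))
    have h3 := hH.card
    rw [Finset.card_univ] at h1
    omega
  · have hex : ∀ x, ∃ v, f x = .inr (.inr (k, v)) := by
      intro x
      have := hcomp x x₁
      simp only [hx₁] at this
      rcases hx : f x with u | ⟨r, b⟩ | ⟨k, a⟩ <;> simp_all [cspComponent]
    choose f' hf' using hex
    obtain ⟨e, he, hei⟩ := hκ k i
    obtain ⟨e', he', rfl⟩ := exists_edge_preimage (f := f')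
      (fun x y h => f.injective (by rw [hf', hf', h])) (fun x y h => by
        have := hadj x y h
        rw [hf', hf'] at this
        exact this.2) he
    refine hei ?_
    rw [← cspColour_copyEdge x₀ c a κ]
    induction e' with
    | h x y =>
      have := (hf x y he').2
      rwa [hf', hf'] at this

end cspColour

/-- Constraints on the colours of the edges of `P` and on auxiliary variables can be realised by a
larger graph. -/
lemma exists_csp_extension [Fintype W] (hH : Robust H) (hq : 2 ≤ q) [Finite V] [Nonempty V]
    [Finite R]
    (A : Sym2 V → R → Prop) (B : R → R → Prop) (C : Sym2 V → R → R → Prop)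
    (hA : ∀ e r, A e r → e ∈ P.edgeSet) (hB : ∀ r r', B r r' → r ≠ r')
    (hC : ∀ e r r', C e r r' → e ∈ P.edgeSet) :
    ∃ (Y : Type) (_ : Finite Y) (G : SimpleGraph Y) (ι : P ↪g G),
      (∀ c : Sym2 Y → Fin q, HFree H G c → ∃ a : R → Fin q,
        (∀ e r, A e r → c (e.map ι) ≠ a r) ∧ (∀ r r', B r r' → a r ≠ a r') ∧
        ∀ e r r', C e r r' → ¬ (c (e.map ι) = a r ∧ a r = a r')) ∧
      ∀ (s : Sym2 V) (c : Sym2 V → Fin q) (a : R → Fin q), HFree H (P.deleteEdges {s}) c →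
        (∀ e r, e ≠ s → A e r → c e ≠ a r) → (∀ r r', B r r' → a r ≠ a r') →
        (∀ e r r', e ≠ s → C e r r' → ¬ (c e = a r ∧ a r = a r')) →
        ∃ c' : Sym2 Y → Fin q, HFree H (G.deleteEdges {s.map ι}) c' := by
  classical
  obtain ⟨g, hg⟩ := hH.exists_edge_classes
  let K : Type := {x : Sym2 V × R × R // C x.1 x.2.1 x.2.2}
  let X := cspBase H R K P
  let slot : K → Fin 3 → Sym2 (V ⊕ R × Bool ⊕ K × W) := fun k =>
    ![k.1.1.map Sum.inl, varEdge k.1.2.1, varEdge k.1.2.2]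
  let Rel : Sym2 (V ⊕ R × Bool ⊕ K × W) → Sym2 (V ⊕ R × Bool ⊕ K × W) → Bool → Prop :=
    fun e f b => (∃ e' r, A e' r ∧ e = e'.map Sum.inl ∧ f = varEdge r ∧ b = false) ∨
      (∃ r r', B r r' ∧ e = varEdge r ∧ f = varEdge r' ∧ b = false) ∨
      ∃ (k : K) (h : Sym2 W), h ∈ H.edgeSet ∧ e = copyEdge k h ∧ f = slot k (g h) ∧ b = true
  have hinl : ∀ e ∈ P.edgeSet, e.map Sum.inl ∈ X.edgeSet := fun e => e.ind fun x y h => h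
  have hvar : ∀ r, varEdge r ∈ X.edgeSet := fun r => ⟨rfl, by simp⟩
  have hcopy : ∀ k, ∀ e ∈ H.edgeSet, copyEdge k e ∈ X.edgeSet := fun k e =>
    e.ind fun x y h => ⟨rfl, h⟩
  have hslot : ∀ k i, slot k i ∈ X.edgeSet := by
    intro k i
    fin_cases i
    exacts [hinl _ (hC _ _ _ k.2), hvar _, hvar _]
  obtain ⟨Y, hY, G, ι, hsound, hcomplete⟩ := exists_constrained_extension (q := q) hH hq X Rel (by
    rintro e f b (⟨e', r, h, rfl, rfl, rfl⟩ | ⟨r, r', h, rfl, rfl, rfl⟩ | ⟨k, h, hh, rfl, rfl, rfl⟩)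
    · refine ⟨hinl _ (hA _ _ h), hvar _, fun v hv hv' => ?_⟩
      obtain ⟨w, -, rfl⟩ := Sym2.mem_map.1 hv
      simp [varEdge] at hv'
    · refine ⟨hvar _, hvar _, fun v hv hv' => ?_⟩
      simp only [varEdge, Sym2.mem_iff] at hv hv'
      have := hB _ _ h
      rcases hv with rfl | rfl <;> simp [this] at hv'
    · refine ⟨hcopy _ _ hh, hslot _ _, fun v hv hv' => ?_⟩
      obtain ⟨w, -, rfl⟩ := Sym2.mem_map.1 hv
      generalize g h = i at hv'
      fin_cases i <;> simp [slot, varEdge] at hv')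
  have : ∀ s : Sym2 V, Sym2.map ι '' (Sym2.map Sum.inl '' {s}) =
      {s.map fun v => ι (Sum.inl v)} := by
    intro s
    simp [Sym2.map_map]
  refine ⟨Y, hY, G, ⟨⟨fun v => ι (.inl v), ι.injective.comp Sum.inl_injective⟩, ι.map_adj_iff⟩,
    ?_, ?_⟩
  · intro c hc
    have hmap : ∀ e : Sym2 V, e.map (fun v => ι (Sum.inl v)) = (e.map Sum.inl).map ι := fun e => by
      rw [Sym2.map_map]; rfl
    refine ⟨fun r => c ((varEdge r).map ι), ?_, ?_, ?_⟩
    · intro e r h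
      have := hsound c hc _ _ _ (Or.inl ⟨e, r, h, rfl, rfl, rfl⟩)
      rw [← hmap] at this
      exact fun h' => Bool.false_ne_true (this.1 h')
    · intro r r' h
      have := hsound c hc _ _ _ (Or.inr (Or.inl ⟨r, r', h, rfl, rfl, rfl⟩))
      simpa using this
    · rintro e r r' h ⟨h1, h2⟩
      let k : K := ⟨(e, r, r'), h⟩
      refine hc ⟨c ((varEdge r).map ι), ⟨fun x => ι (.inr (.inr (k, x))), fun x y h => ?_⟩,
        fun x y hxy => ⟨ι.map_adj_iff.2 ⟨rfl, hxy⟩, ?_⟩⟩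
      · simpa using ι.injective h
      · have h3 := (hsound c hc _ _ _ (Or.inr (Or.inr ⟨k, s(x, y), hxy, rfl, rfl, rfl⟩))).2 rfl
        change c ((copyEdge k s(x, y)).map ι) = _
        rw [h3]
        generalize g s(x, y) = i
        fin_cases i
        · exact (congrArg c (hmap e)).symm.trans h1
        · rfl
        · exact h2.symm
  · intro s c a hc hcA hcB hcC
    have hfill : ∀ k : K, ∃ κ : Fin 3 → Fin q, (k.1.1 ≠ s → κ 0 = c k.1.1) ∧ κ 1 = a k.1.2.1 ∧
        κ 2 = a k.1.2.2 ∧ ∀ i, ∃ j, κ j ≠ i := by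
      rintro ⟨⟨e, r, r'⟩, h⟩
      have key : ∀ x, ¬ (x = a r ∧ a r = a r') → ∀ i, ∃ j, ![x, a r, a r'] j ≠ i := by
        intro x hx i
        by_contra! hcon
        have h0 := hcon 0
        have h1 := hcon 1
        have h2 := hcon 2
        simp only [Matrix.cons_val] at h0 h1 h2
        exact hx ⟨h0.trans h1.symm, h1.trans h2.symm⟩
      by_cases he : e = s
      · have : Nontrivial (Fin q) := Fin.nontrivial_iff_two_le.2 hq
        obtain ⟨x, hx⟩ := exists_ne (a r)
        exact ⟨![x, a r, a r'], fun h => absurd he h, rfl, rfl, key x fun h => hx h.1⟩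
      · exact ⟨![c e, a r, a r'], fun _ => rfl, rfl, rfl, key _ (hcC _ _ _ he h)⟩
    choose κ hκ0 hκ1 hκ2 hκ using hfill
    let x₀ : Fin q := ⟨0, by omega⟩
    have hcX := cspColour_hFree (P := P) x₀ c a (fun k e => κ k (g e)) hH hc (by
      intro k i
      obtain ⟨j, hj⟩ := hκ k i
      obtain ⟨e, he, rfl⟩ := hg j
      exact ⟨e, he, hj⟩)
    obtain ⟨c', hc'⟩ := hcomplete _ _ hcX (by
      rintro e f b (⟨e', r, h, rfl, rfl, rfl⟩ | ⟨r, r', h, rfl, rfl, rfl⟩ |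
        ⟨k, h, hh, rfl, rfl, rfl⟩) hes hfs
      · rw [cspColour_inl, cspColour_varEdge]
        simpa using hcA e' r (fun h' => hes ⟨s, rfl, by rw [h']⟩) h
      · rw [cspColour_varEdge, cspColour_varEdge]
        simpa using hcB r r' h
      · rw [cspColour_copyEdge]
        simp only [iff_true]
        generalize g h = i at hfs ⊢
        fin_cases i
        · change _ = cspColour _ _ _ _ (k.1.1.map Sum.inl)
          rw [cspColour_inl]
          exact hκ0 k fun h' => hfs ⟨s, rfl, by simp [slot, h']⟩
        · change _ = cspColour _ _ _ _ (varEdge _)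
          rw [cspColour_varEdge]
          exact hκ1 k
        · change _ = cspColour _ _ _ _ (varEdge _)
          rw [cspColour_varEdge]
          exact hκ2 k)
    rw [this] at hc'
    exact ⟨c', hc'⟩

end

section

variable {W : Type} [Fintype W] {H : SimpleGraph W} {q : ℕ} {V : Type}

/-- Every graph `P` that is not Ramsey is an induced subgraph of a Ramsey graph in which all edges
of `P` are critical. -/
lemma exists_critical_extension (hH : Robust H) (hq : 2 ≤ q) [Finite V] [Nonempty V]
    {P : SimpleGraph V} (hP : ¬ IsRamsey q P H) :
    ∃ (Y : Type) (_ : Finite Y) (G : SimpleGraph Y) (ι : P ↪g G), IsRamsey q G H ∧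
      ∀ s ∈ P.edgeSet, ¬ IsRamsey q (G.deleteEdges {s.map ι}) H := by
  classical
  obtain ⟨r, rfl⟩ := Nat.exists_eq_add_of_le' hq
  obtain ⟨φ, hφ⟩ := not_isRamsey_iff.1 hP
  obtain ⟨m, ⟨E⟩⟩ := Finite.exists_equiv_fin P.edgeSet
  let e : Fin m → Sym2 V := fun k => (E.symm k).1
  have he : ∀ k, e k ∈ P.edgeSet := fun k => (E.symm k).2
  let j : Fin m → Fin (r + 2) := fun k => if φ (e k) = 0 then 1 else φ (e k)
  have hj : ∀ k, j k ≠ 0 := by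
    intro k
    by_cases h : φ (e k) = 0 <;> simp [j, h]
  have hjφ : ∀ k, φ (e k) ≠ 0 → j k = φ (e k) := fun k h => if_neg h
  let pal : Fin (r + 2) → Fin (r + 2) ⊕ Fin (m + 1) ⊕ Fin m := .inl
  let x : Fin (m + 1) → Fin (r + 2) ⊕ Fin (m + 1) ⊕ Fin m := fun k => .inr (.inl k)
  let v : Fin m → Fin (r + 2) ⊕ Fin (m + 1) ⊕ Fin m := fun k => .inr (.inr k)
  let A : Sym2 V → Fin (r + 2) ⊕ Fin (m + 1) ⊕ Fin m → Prop := fun s t =>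
    ∃ k i, i ≠ φ (e k) ∧ s = e k ∧ t = pal i
  let B : Fin (r + 2) ⊕ Fin (m + 1) ⊕ Fin m →
      Fin (r + 2) ⊕ Fin (m + 1) ⊕ Fin m → Prop := fun s t =>
    (∃ i i', i ≠ i' ∧ s = pal i ∧ t = pal i') ∨ (∃ i, i ≠ 0 ∧ s = x 0 ∧ t = pal i) ∨
    (∃ k i, i ≠ 0 ∧ i ≠ j k ∧ s = v k ∧ t = pal i) ∨
    (∃ k i, i ≠ 0 ∧ i ≠ j k ∧ s = x k.succ ∧ t = pal i) ∨
    (∃ k, φ (e k) = 0 ∧ s = v k ∧ t = x k.succ) ∨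
    (∃ k, φ (e k) ≠ 0 ∧ s = x k.castSucc ∧ t = v k) ∨ (s = x (Fin.last m) ∧ t = pal 0)
  let C : Sym2 V → Fin (r + 2) ⊕ Fin (m + 1) ⊕ Fin m →
      Fin (r + 2) ⊕ Fin (m + 1) ⊕ Fin m → Prop := fun s t t' =>
    (∃ k, φ (e k) = 0 ∧ s = e k ∧ t = x k.castSucc ∧ t' = v k) ∨
    (∃ k, φ (e k) ≠ 0 ∧ s = e k ∧ t = v k ∧ t' = x k.succ)
  obtain ⟨Y, hY, G, ι, hsound, hcomplete⟩ := exists_csp_extension (q := r + 2) P hH hq A B C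
    (by rintro _ _ ⟨k, i, -, rfl, -⟩; exact he k)
    (by
      rintro _ _ (⟨i, i', h, rfl, rfl⟩ | ⟨i, -, rfl, rfl⟩ | ⟨k, i, -, -, rfl, rfl⟩ |
        ⟨k, i, -, -, rfl, rfl⟩ | ⟨k, -, rfl, rfl⟩ | ⟨k, -, rfl, rfl⟩ | ⟨rfl, rfl⟩)
      · simpa [pal] using h
      all_goals simp [pal, x, v])
    (by rintro _ _ _ (⟨k, -, rfl, -, -⟩ | ⟨k, -, rfl, -, -⟩) <;> exact he k)
  refine ⟨Y, hY, G, ι, ?_, ?_⟩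
  · by_contra hG
    obtain ⟨c, hc⟩ := not_isRamsey_iff.1 hG
    obtain ⟨a, hA, hB, hC⟩ := hsound c hc
    have hpal : Function.Injective fun i => a (pal i) := by
      intro i i' h
      by_contra hne
      exact hB _ _ (Or.inl ⟨i, i', hne, rfl, rfl⟩) h
    have hsurj := Finite.surjective_of_injective hpal
    have hedge : ∀ k, c ((e k).map ι) = a (pal (φ (e k))) := by
      intro k
      obtain ⟨i, hi⟩ := hsurj (c ((e k).map ι))
      by_contra h
      exact hA (e k) (pal i) ⟨k, i, fun h' => h (by rw [← hi, h']), rfl, rfl⟩ hi.symm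
    have hpair : ∀ k t, (∀ i, i ≠ 0 → i ≠ j k → B t (pal i)) →
        a t = a (pal 0) ∨ a t = a (pal (j k)) := by
      intro k t h
      obtain ⟨i, hi⟩ := hsurj (a t)
      by_cases h0 : i = 0
      · exact Or.inl (by rw [← hi, h0])
      by_cases h1 : i = j k
      · exact Or.inr (by rw [← hi, h1])
      exact absurd hi.symm (hB _ _ (h i h0 h1))
    have hv : ∀ k, a (v k) = a (pal 0) ∨ a (v k) = a (pal (j k)) := fun k =>
      hpair k _ fun i h0 h1 => Or.inr (Or.inr (Or.inl ⟨k, i, h0, h1, rfl, rfl⟩))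
    have hx : ∀ k : Fin m, a (x k.succ) = a (pal 0) ∨ a (x k.succ) = a (pal (j k)) := fun k =>
      hpair k _ fun i h0 h1 => Or.inr (Or.inr (Or.inr (Or.inl ⟨k, i, h0, h1, rfl, rfl⟩)))
    have hind : ∀ k, a (x k) = a (pal 0) := by
      intro k
      induction k using Fin.induction with
      | zero =>
        obtain ⟨i, hi⟩ := hsurj (a (x 0))
        by_contra h
        exact hB _ _ (Or.inr (Or.inl ⟨i, fun h' => h (by rw [← hi, h']), rfl, rfl⟩)) hi.symm
      | succ k ih =>
        by_cases h : φ (e k) = 0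
        · have h1 := hB _ _ (Or.inr (Or.inr (Or.inr (Or.inr (Or.inl ⟨k, h, rfl, rfl⟩)))))
          have h2 := hC _ _ _ (Or.inl ⟨k, h, rfl, rfl, rfl⟩)
          rw [hedge, h, ih] at h2
          rcases hv k with h3 | h3
          · exact absurd ⟨rfl, h3.symm⟩ h2
          · rcases hx k with h4 | h4
            · exact h4
            · exact absurd (h3.trans h4.symm) h1
        · have h1 := hB _ _ (Or.inr (Or.inr (Or.inr (Or.inr (Or.inr (Or.inl ⟨k, h, rfl, rfl⟩))))))
          have h2 := hC _ _ _ (Or.inr ⟨k, h, rfl, rfl, rfl⟩)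
          rw [hedge, ← hjφ k h] at h2
          rcases hv k with h3 | h3
          · exact absurd (ih.trans h3.symm) h1
          · rcases hx k with h4 | h4
            · exact h4
            · exact absurd ⟨h3.symm, h3.trans h4.symm⟩ h2
    exact hB _ _ (Or.inr (Or.inr (Or.inr (Or.inr (Or.inr (Or.inr ⟨rfl, rfl⟩)))))) (hind _)
  · intro s hs
    obtain ⟨k₀, rfl⟩ : ∃ k, e k = s := ⟨E ⟨s, hs⟩, by simp [e]⟩
    have hne : ∀ k, e k ≠ e k₀ → k ≠ k₀ := fun k h h' => h (by rw [h'])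
    let xv : Fin (m + 1) → Fin (r + 2) := Fin.cases 0 fun k => if k < k₀ then 0 else j k
    let vv : Fin m → Fin (r + 2) := fun k =>
      if k < k₀ ∨ k = k₀ ∧ φ (e k) ≠ 0 then j k else 0
    have hx0 : xv 0 = 0 := rfl
    have hxs : ∀ k : Fin m, xv k.succ = if k < k₀ then 0 else j k := fun k => rfl
    have hxle : ∀ k : Fin m, k ≤ k₀ → xv k.castSucc = 0 := by
      intro k hk
      refine Fin.cases (motive := fun l => l = k.castSucc → xv l = 0) (fun _ => rfl)
        (fun l hl => ?_) k.castSucc rfl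
      rw [hxs, if_pos]
      have : l.val + 1 = k.val := congrArg Fin.val hl
      rw [Fin.le_def] at hk
      rw [Fin.lt_def]
      omega
    have hxgt : ∀ k : Fin m, k₀ < k → xv k.castSucc ≠ 0 := by
      intro k hk
      refine Fin.cases (motive := fun l => l = k.castSucc → xv l ≠ 0) (fun h => ?_)
        (fun l hl => ?_) k.castSucc rfl
      · have : 0 = k.val := congrArg Fin.val h
        rw [Fin.lt_def] at hk
        omega
      · rw [hxs, if_neg]
        · exact hj l
        · have : l.val + 1 = k.val := congrArg Fin.val hl
          rw [Fin.lt_def] at hk ⊢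
          omega
    obtain ⟨c, hc⟩ := hcomplete (e k₀) φ (Sum.elim id (Sum.elim xv vv))
      (hφ.mono (deleteEdges_le _))
      (by
        rintro _ _ - ⟨k, i, h, rfl, rfl⟩
        exact h.symm)
      (by
        rintro _ _ (⟨i, i', h, rfl, rfl⟩ | ⟨i, h, rfl, rfl⟩ | ⟨k, i, h, h', rfl, rfl⟩ |
          ⟨k, i, h, h', rfl, rfl⟩ | ⟨k, h, rfl, rfl⟩ | ⟨k, h, rfl, rfl⟩ | ⟨rfl, rfl⟩)
        · exact h
        · exact h.symm
        · change vv k ≠ i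
          simp only [vv]
          split_ifs
          exacts [h'.symm, h.symm]
        · change xv k.succ ≠ i
          rw [hxs]
          split_ifs
          exacts [h.symm, h'.symm]
        · change vv k ≠ xv k.succ
          rw [hxs]
          simp only [vv, h, ne_eq, not_true, and_false, or_false]
          split_ifs
          exacts [hj k, (hj k).symm]
        · change xv k.castSucc ≠ vv k
          simp only [vv, h, ne_eq, not_false_eq_true, and_true, ← le_iff_lt_or_eq]
          split_ifs with hk
          · rw [hxle k hk]
            exact (hj k).symm
          · exact hxgt k (not_le.1 hk)
        · change xv (Fin.last m) ≠ 0
          have hm : Fin.last m = Fin.succ ⟨m - 1, by have := k₀.2; omega⟩ :=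
            Fin.ext (by have := k₀.2; simp; omega)
          rw [hm, hxs, if_neg]
          · exact hj _
          · rw [Fin.lt_def]
            have := k₀.2
            simp only
            omega)
      (by
        rintro _ _ _ hs (⟨k, h, rfl, rfl, rfl⟩ | ⟨k, h, rfl, rfl, rfl⟩) ⟨h1, h2⟩
        · change φ (e k) = xv k.castSucc at h1
          change xv k.castSucc = vv k at h2
          rcases lt_or_gt_of_ne (hne k hs) with hk | hk
          · rw [hxle k hk.le] at h2
            simp only [vv, hk, true_or, if_true] at h2
            exact hj k h2.symm
          · exact hxgt k hk (h1.symm.trans h)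
        · change φ (e k) = vv k at h1
          change vv k = xv k.succ at h2
          rcases lt_or_gt_of_ne (hne k hs) with hk | hk
          · rw [hxs, if_pos hk] at h2
            exact h (h1.trans h2)
          · simp only [vv, hk.not_gt, hk.ne', false_and, or_self, if_false] at h1
            exact h h1)
    exact not_isRamsey_iff.2 ⟨c, hc⟩

end

section

variable {W : Type} [Fintype W] {H : SimpleGraph W} {q : ℕ} {V V' : Type}

/-- Isolated vertices are irrelevant for being Ramsey. -/
lemma isRamsey_comap (hH : Robust H) (hq : 0 < q) {M : SimpleGraph V} (hM : IsRamsey q M H)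
    (ψ : V' ↪ V) (hψ : ∀ x y, M.Adj x y → ∃ x', ψ x' = x) : IsRamsey q (M.comap ψ) H := by
  by_contra hG
  obtain ⟨c, hc⟩ := not_isRamsey_iff.1 hG
  obtain ⟨i, f, hf⟩ := hM (Function.extend (Sym2.map ψ) c fun _ => ⟨0, hq⟩)
  have hex : ∀ a, ∃ x, ψ x = f a := fun a => by
    obtain ⟨b, hb, -⟩ := hH.exists_adj_ne a a
    exact hψ _ _ (hf a b hb).1
  choose f' hf' using hex
  refine hc ⟨i, ⟨f', fun a b h => f.injective (by rw [← hf', ← hf', h])⟩, fun a b h => ?_⟩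
  have := hf a b h
  rw [← hf', ← hf', ← Sym2.map_mk, (Sym2.map.injective ψ.injective).extend_apply] at this
  exact this

/-- The graph obtained from `F` by attaching a pendant edge to every vertex. -/
def pendant (F : SimpleGraph V) : SimpleGraph (V × Bool) where
  Adj u v := (u.2 = false ∧ v.2 = false ∧ F.Adj u.1 v.1) ∨ (u.1 = v.1 ∧ u.2 ≠ v.2)
  symm := ⟨by
    rintro u v (⟨h1, h2, h3⟩ | ⟨h1, h2⟩)
    exacts [Or.inl ⟨h2, h1, h3.symm⟩, Or.inr ⟨h1.symm, h2.symm⟩]⟩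
  loopless := ⟨by
    rintro u (⟨-, -, h⟩ | ⟨-, h⟩)
    exacts [h.ne rfl, h rfl]⟩

lemma pendant_not_isRamsey (hH : Robust H) {F : SimpleGraph V} (hF : ¬ IsRamsey q F H) :
    ¬ IsRamsey q (pendant F) H := by
  obtain ⟨c, hc⟩ := not_isRamsey_iff.1 hF
  refine not_isRamsey_iff.2 ⟨c ∘ Sym2.map Prod.fst, ?_⟩
  rintro ⟨i, f, hf⟩
  have hfalse : ∀ a, (f a).2 = false := by
    intro a
    by_contra ha
    rw [Bool.not_eq_false] at ha
    have key : ∀ b, H.Adj a b → f b = ((f a).1, false) := by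
      intro b hb
      rcases (hf a b hb).1 with ⟨h, -, -⟩ | ⟨h1, h2⟩
      · rw [ha] at h
        cases h
      · rw [ha] at h2
        exact Prod.ext h1.symm (by simpa using h2.symm)
    obtain ⟨b, hb, -⟩ := hH.exists_adj_ne a a
    obtain ⟨b', hb', hne⟩ := hH.exists_adj_ne a b
    exact hne (f.injective ((key b' hb').trans (key b hb).symm))
  refine hc ⟨i, ⟨fun a => (f a).1, fun a b h => f.injective (Prod.ext h ?_)⟩, fun a b h => ⟨?_, ?_⟩⟩
  · rw [hfalse, hfalse]
  · rcases (hf a b h).1 with h' | h'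
    · exact h'.2.2
    · exact absurd ((hfalse a).trans (hfalse b).symm) h'.2
  · exact (hf a b h).2

/-- Every non-Ramsey graph without isolated vertices is an induced subgraph of a minimal Ramsey
graph. -/
lemma exists_isRamseyMinimal (hH : Robust H) (hq : 2 ≤ q) [Finite V] [Nonempty V]
    {P : SimpleGraph V} (hP : ¬ IsRamsey q P H) (hiso : ∀ v, ∃ w, P.Adj v w) :
    ∃ (n : ℕ) (G : SimpleGraph (Fin n)), IsRamseyMinimal q G H ∧ Nonempty (P ↪g G) := by
  obtain ⟨Y, hY, G, ι, hG, hcrit⟩ := exists_critical_extension hH hq hP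
  obtain ⟨M, hMG, hM, hmin⟩ :=
    exists_minimal_le_of_wellFoundedLT (fun M : SimpleGraph Y => IsRamsey q M H) G hG
  have hPM : ∀ u v, P.Adj u v → M.Adj (ι u) (ι v) := by
    intro u v huv
    by_contra hnot
    refine hcrit s(u, v) huv fun c => ?_
    by_contra hc
    refine HFree.mono (G := M) (fun x y hxy => deleteEdges_adj.2 ⟨hMG hxy, fun hmem => hnot ?_⟩)
      hc (hM c)
    have hmem' : s(x, y) = s(ι u, ι v) := hmem
    rw [← mem_edgeSet, ← hmem']
    exact hxy
  obtain ⟨n, ⟨σ⟩⟩ := Finite.exists_equiv_fin M.support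
  let ψ : Fin n ↪ Y := σ.symm.toEmbedding.trans (Function.Embedding.subtype _)
  have hψ : ∀ x y, M.Adj x y → ∃ i, ψ i = x := fun x y h =>
    ⟨σ ⟨x, y, h⟩, by simp [ψ]⟩
  have hψ' : ∀ i, ∃ y, M.Adj (ψ i) y := fun i => (σ.symm i).2
  refine ⟨n, M.comap ψ, ⟨isRamsey_comap hH (by omega) hM ψ hψ, fun G' hne hG' => hne ?_⟩, ?_⟩
  · let M' : SimpleGraph Y := G'.coe.map ((Function.Embedding.subtype _).trans ψ)
    have hM' : M ≤ M' := by
      refine hmin (fun c => ?_) ?_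
      · by_contra hc
        refine HFree.comap (fun x : G'.verts => ψ x) (ψ.injective.comp Subtype.val_injective)
          (fun u v h => ?_) hc (hG' _)
        exact ⟨fun h' => h.ne (Subtype.ext (ψ.injective h')), u, v, h, rfl, rfl⟩
      · rintro _ _ ⟨-, u, v, h, rfl, rfl⟩
        exact G'.adj_sub h
    have hadj : ∀ i j, M.Adj (ψ i) (ψ j) → G'.Adj i j := by
      intro i j h
      obtain ⟨-, u, v, huv, hu, hv⟩ := hM' h
      have hu' : u.1 = i := ψ.injective hu
      have hv' : v.1 = j := ψ.injective hv
      rw [← hu', ← hv']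
      exact huv
    have hverts : ∀ i, i ∈ G'.verts := by
      intro i
      obtain ⟨y, hy⟩ := hψ' i
      obtain ⟨j, rfl⟩ := hψ y _ hy.symm
      exact (hadj i j hy).fst_mem
    refine Subgraph.ext (Set.eq_univ_of_forall hverts) ?_
    ext i j
    exact ⟨fun h => G'.adj_sub h, fun h => hadj i j h⟩
  · have hex : ∀ v, ∃ i, ψ i = ι v := fun v => by
      obtain ⟨w, hw⟩ := hiso v
      exact hψ _ _ (hPM _ _ hw)
    choose κ hκ using hex
    refine ⟨⟨⟨κ, fun u v h => ι.injective (by rw [← hκ, ← hκ, h])⟩, fun {u v} => ?_⟩⟩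
    change M.Adj (ψ (κ u)) (ψ (κ v)) ↔ _
    rw [hκ, hκ]
    exact ⟨fun h => ι.map_adj_iff.1 (hMG h), hPM u v⟩

end

end RamseySender

/-- If `H` is 3-connected or a triangle, `q ≥ 2`, and `F` is not
`q`-Ramsey for `H`, then `F` is an induced subgraph of infinitely many
`q`-Ramsey-minimal graphs for `H`. -/
theorem stmt1 {VH VF : Type} [Fintype VH] [Fintype VF]
    (H : SimpleGraph VH) (hH : ThreeConnOrK3 H)
    (q : ℕ) (hq : 2 ≤ q)
    (F : SimpleGraph VF) (hF : ¬ IsRamsey q F H) :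
    ∀ N : ℕ, ∃ (n : ℕ) (G : SimpleGraph (Fin n)),
      N < n ∧ IsRamseyMinimal q G H ∧ Nonempty (F ↪g G) := by
  intro N
  have hH' := RamseySender.robust_of_threeConnOrK3 hH
  let F' : SimpleGraph (VF ⊕ Fin (N + 1)) := F ⊕g ⊥
  have hF' : ¬ IsRamsey q F' H := by
    intro h
    refine hF ?_
    have := RamseySender.isRamsey_comap hH' (by omega) h Function.Embedding.inl (by
      rintro (x | x) (y | y) hxy
      · exact ⟨x, rfl⟩
      · exact ⟨x, rfl⟩
      · simp [F'] at hxy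
      · simp [F'] at hxy)
    convert this
    ext x y
    simp [F']
  obtain ⟨n, G, hG, ⟨ι⟩⟩ := RamseySender.exists_isRamseyMinimal hH' hq
    (RamseySender.pendant_not_isRamsey hH' hF') fun v => ⟨(v.1, !v.2), Or.inr ⟨rfl, by simp⟩⟩
  refine ⟨n, G, ?_, hG, ⟨RelEmbedding.trans
    ⟨⟨fun v => (Sum.inl v, false), fun u v h => by simpa using h⟩, fun {u v} => ?_⟩ ι⟩⟩
  · have := Fintype.card_le_of_injective ι ι.injective
    simp only [Fintype.card_prod, Fintype.card_sum, Fintype.card_fin, Fintype.card_bool] at this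
    omega
  · change (false = false ∧ false = false ∧ F.Adj u v) ∨
      ((Sum.inl u : VF ⊕ Fin (N + 1)) = Sum.inl v ∧ false ≠ false) ↔ _
    simp
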